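/- arXiv:2012.13069 — 2 statements merged into one kernel-verified Lean document; each statement's English description precedes it below -/
import Mathlib

section
/- Let n ≥ 3 and let R₀ : ℝ^n → ℝ be continuous with R₀ ≥ 0. Let φ : ℝ^n → ℝ be a C² function with φ > 0 such that f := −c_n Δφ + R₀ φ satisfies f(x) ≥ 0 for all x. Let ū : ℝ^n → ℝ be a C² function with ū > 0 and −c_n Δū = f on all of ℝ^n, and suppose there are θ ∈ (0,1) and a compact set K ⊆ ℝ^n such that ū(x) ≤ θ φ(x) for all x ∉ K. Then there exists a C² function w : ℝ^n → ℝ with 0 < w(x) ≤ φ(x) for all x, satisfying −c_n Δw + R₀ w = 0 on all of ℝ^n and w(x) ≥ (1 − θ) φ(x) for all x ∉ K. -/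
open Filter

/-- The Euclidean Laplacian on `ℝ^n`: the sum of the second partial derivatives. -/
noncomputable def lap {n : ℕ} (f : EuclideanSpace ℝ (Fin n) → ℝ)
    (x : EuclideanSpace ℝ (Fin n)) : ℝ :=
  ∑ i, fderiv ℝ (fun y => fderiv ℝ f y (EuclideanSpace.single i 1)) x (EuclideanSpace.single i 1)

section

open scoped Topology ContDiff

/-- Euclidean `n`-space. -/
abbrev Euc (n : ℕ) := EuclideanSpace ℝ (Fin n)

/-- The standard basis vectors of `ℝ^n`. -/
noncomputable abbrev stdVec {n : ℕ} (i : Fin n) : Euc n := EuclideanSpace.single i 1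

variable {n : ℕ}

theorem ContDiff.fderiv_apply_const {f : Euc n → ℝ} {k m : ℕ∞} (hf : ContDiff ℝ k f)
    (hm : m + 1 ≤ k) (e : Euc n) : ContDiff ℝ m (fun y => fderiv ℝ f y e) :=
  ContDiff.clm_apply (hf.fderiv_right (by exact_mod_cast hm)) contDiff_const

theorem contDiff_one_fderiv_apply {f : Euc n → ℝ} (hf : ContDiff ℝ 2 f) (e : Euc n) :
    ContDiff ℝ 1 (fun y => fderiv ℝ f y e) :=
  ContDiff.clm_apply (hf.fderiv_right (by norm_num)) contDiff_const

theorem continuous_fderiv_fderiv_apply {f : Euc n → ℝ} (hf : ContDiff ℝ 2 f) (e : Euc n) :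
    Continuous (fun x => fderiv ℝ (fun y => fderiv ℝ f y e) x e) :=
  ((contDiff_one_fderiv_apply hf e).continuous_fderiv one_ne_zero).clm_apply continuous_const

theorem continuous_lap {f : Euc n → ℝ} (hf : ContDiff ℝ 2 f) : Continuous (lap f) :=
  continuous_finsetSum _ fun i _ => continuous_fderiv_fderiv_apply hf (stdVec i)

theorem lap_add {f g : Euc n → ℝ} (hf : ContDiff ℝ 2 f) (hg : ContDiff ℝ 2 g) (x : Euc n) :
    lap (fun y => f y + g y) x = lap f x + lap g x := by
  simp only [lap, ← Finset.sum_add_distrib]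
  refine Finset.sum_congr rfl fun i _ => ?_
  have h : (fun y => fderiv ℝ (fun y => f y + g y) y (stdVec i))
      = fun y => fderiv ℝ f y (stdVec i) + fderiv ℝ g y (stdVec i) := by
    ext y
    rw [fderiv_fun_add (hf.differentiable two_ne_zero y) (hg.differentiable two_ne_zero y)]
    rfl
  rw [h, fderiv_fun_add ((contDiff_one_fderiv_apply hf _).differentiable one_ne_zero x)
    ((contDiff_one_fderiv_apply hg _).differentiable one_ne_zero x)]
  rfl

theorem lap_const_mul {f : Euc n → ℝ} (hf : ContDiff ℝ 2 f) (c : ℝ) (x : Euc n) :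
    lap (fun y => c * f y) x = c * lap f x := by
  simp only [lap, Finset.mul_sum]
  refine Finset.sum_congr rfl fun i _ => ?_
  have h : (fun y => fderiv ℝ (fun y => c * f y) y (stdVec i))
      = fun y => c * fderiv ℝ f y (stdVec i) := by
    ext y
    rw [fderiv_const_mul (hf.differentiable two_ne_zero y)]
    rfl
  rw [h, fderiv_const_mul ((contDiff_one_fderiv_apply hf _).differentiable one_ne_zero x)]
  rfl

theorem lap_sub {f g : Euc n → ℝ} (hf : ContDiff ℝ 2 f) (hg : ContDiff ℝ 2 g) (x : Euc n) :
    lap (fun y => f y - g y) x = lap f x - lap g x := by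
  have h := lap_add hf (g := fun y => -1 * g y) (contDiff_const.mul hg) x
  rw [lap_const_mul hg] at h
  simpa [sub_eq_add_neg] using h

theorem fderiv_comp_affine_apply {f : Euc n → ℝ} (hf : Differentiable ℝ f) (s : ℝ) (x y e : Euc n) :
    fderiv ℝ (fun y => f (s • y + x)) y e = s * fderiv ℝ f (s • y + x) e := by
  have h1 : HasFDerivAt (fun y : Euc n => s • y + x) (s • ContinuousLinearMap.id ℝ (Euc n)) y :=
    ((hasFDerivAt_id y).const_smul s).add_const x
  have h := ((hf (s • y + x)).hasFDerivAt.comp y h1).fderiv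
  have h' : (f ∘ fun y => s • y + x) = fun y => f (s • y + x) := rfl
  rw [← h', h]
  simp

theorem lap_comp_affine {f : Euc n → ℝ} (hf : ContDiff ℝ 2 f) (s : ℝ) (x y : Euc n) :
    lap (fun y => f (s • y + x)) y = s ^ 2 * lap f (s • y + x) := by
  simp only [lap, Finset.mul_sum]
  refine Finset.sum_congr rfl fun i _ => ?_
  have h : (fun y => fderiv ℝ (fun y => f (s • y + x)) y (stdVec i))
      = fun y => s * fderiv ℝ f (s • y + x) (stdVec i) :=
    funext fun y => fderiv_comp_affine_apply (hf.differentiable two_ne_zero) s x y _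
  have hd := (contDiff_one_fderiv_apply hf (stdVec i)).differentiable one_ne_zero
  have hd' : DifferentiableAt ℝ (fun y => fderiv ℝ f (s • y + x) (stdVec i)) y :=
    (hd (s • y + x)).comp (f := fun y => s • y + x) y (by fun_prop)
  rw [h, fderiv_const_mul hd']
  simp only [smul_apply, smul_eq_mul]
  rw [fderiv_comp_affine_apply hd]
  ring

/-- Laplacian of a radial function `h (‖x‖²)`. -/
theorem lap_radial {h : ℝ → ℝ} (hh : ContDiff ℝ 2 h) (x : Euc n) :
    lap (fun y => h (‖y‖ ^ 2)) x
      = 2 * n * deriv h (‖x‖ ^ 2) + 4 * ‖x‖ ^ 2 * deriv (deriv h) (‖x‖ ^ 2) := by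
  have hd : Differentiable ℝ h := hh.differentiable two_ne_zero
  have hd' : Differentiable ℝ (deriv h) := by
    have : ContDiff ℝ (1 + 1) h := by simpa [one_add_one_eq_two] using hh
    exact (contDiff_succ_iff_deriv.1 this).2.2.differentiable one_ne_zero
  have key : ∀ {k : ℝ → ℝ}, Differentiable ℝ k → ∀ (y : Euc n),
      HasFDerivAt (fun y : Euc n => k (‖y‖ ^ 2)) (deriv k (‖y‖ ^ 2) • (2 • innerSL ℝ y)) y := by
    intro k hk y
    exact (hk (‖y‖ ^ 2)).hasDerivAt.comp_hasFDerivAt y (hasStrictFDerivAt_norm_sq y).hasFDerivAt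
  have hin : ∀ (y : Euc n) (i : Fin n), inner ℝ y (stdVec i) = y i := by
    intro y i
    simp [stdVec, EuclideanSpace.inner_single_right]
  have hfst : ∀ i : Fin n, (fun y => fderiv ℝ (fun y : Euc n => h (‖y‖ ^ 2)) y (stdVec i))
      = fun y => 2 * (deriv h (‖y‖ ^ 2) * y i) := by
    intro i
    ext y
    rw [(key hd y).fderiv]
    simp only [smul_apply, innerSL_apply_apply, hin, smul_eq_mul]
    simp
    ring
  have hcoord : ∀ (i : Fin n), HasFDerivAt (fun y : Euc n => y i)
      (EuclideanSpace.proj i : Euc n →L[ℝ] ℝ) x := fun i =>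
    (EuclideanSpace.proj i : Euc n →L[ℝ] ℝ).hasFDerivAt
  have hsnd : ∀ i : Fin n, fderiv ℝ (fun y => fderiv ℝ (fun y : Euc n => h (‖y‖ ^ 2)) y
      (stdVec i)) x (stdVec i)
      = 2 * deriv h (‖x‖ ^ 2) + 4 * deriv (deriv h) (‖x‖ ^ 2) * (x i) ^ 2 := by
    intro i
    have hm : HasFDerivAt (fun y : Euc n => 2 * (deriv h (‖y‖ ^ 2) * y i)) _ x :=
      ((key hd' x).mul (hcoord i)).const_mul 2
    rw [hfst, hm.fderiv]
    simp only [smul_apply, add_apply, innerSL_apply_apply,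
      hin, smul_eq_mul]
    simp [stdVec]
    ring
  unfold lap
  rw [Finset.sum_congr rfl fun i _ => hsnd i, Finset.sum_add_distrib, ← Finset.mul_sum,
    ← Finset.mul_sum, ← EuclideanSpace.real_norm_sq_eq]
  simp
  ring

/-- The `2n+1`-point second difference operator, a discretisation of `r² Δ`. -/
noncomputable def secondDiff (r : ℝ) (f : Euc n → ℝ) (x : Euc n) : ℝ :=
  ∑ i, (f (x + r • stdVec i) + f (x - r • stdVec i) - 2 * f x)

theorem exists_second_difference_eq {f : Euc n → ℝ} (hf : ContDiff ℝ 2 f) (x e : Euc n) {r : ℝ}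
    (hr : 0 < r) : ∃ t : ℝ, |t| ≤ r ∧ f (x + r • e) + f (x - r • e) - 2 * f x
      = r ^ 2 * fderiv ℝ (fun y => fderiv ℝ f y e) (x + t • e) e := by
  set g : Euc n → ℝ := fun y => fderiv ℝ f y e with hg
  have key : ∀ {k : Euc n → ℝ}, Differentiable ℝ k → ∀ s : ℝ,
      HasDerivAt (fun s : ℝ => k (x + s • e)) (fderiv ℝ k (x + s • e) e) s := by
    intro k hk s
    have h1 : HasDerivAt (fun s : ℝ => x + s • e) e s := by
      simpa using ((hasDerivAt_id s).smul_const e).const_add x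
    exact (hk (x + s • e)).hasFDerivAt.comp_hasDerivAt s h1
  have hf1 : Differentiable ℝ f := hf.differentiable two_ne_zero
  have hg1 : Differentiable ℝ g := (contDiff_one_fderiv_apply hf e).differentiable one_ne_zero
  have hG : ∀ s : ℝ, HasDerivAt (fun s : ℝ => f (x + s • e) + f (x + (-s) • e))
      (g (x + s • e) - g (x + (-s) • e)) s := by
    intro s
    have h2 := (key hf1 (-s)).scomp s (hasDerivAt_neg s)
    convert! (key hf1 s).add h2 using 1
    simp [hg, sub_eq_add_neg]
  have hQ : ∀ s : ℝ, HasDerivAt (fun s : ℝ => s ^ 2) (2 * s) s := by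
    intro s
    simpa using hasDerivAt_pow 2 s
  obtain ⟨c, hc, hc'⟩ := exists_ratio_hasDerivAt_eq_ratio_slope _ _ hr
    (fun s _ => (hG s).continuousAt.continuousWithinAt) (fun s _ => hG s) _ _
    (fun s _ => (hQ s).continuousAt.continuousWithinAt) (fun s _ => hQ s)
  obtain ⟨d, hd, hd'⟩ := exists_hasDerivAt_eq_slope (fun s : ℝ => g (x + s • e)) _
    (show -c < c by linarith [hc.1])
    (fun s _ => (key hg1 s).continuousAt.continuousWithinAt) (fun s _ => key hg1 s)
  refine ⟨d, abs_le.2 ⟨by linarith [hd.1, hc.2], by linarith [hd.2, hc.2]⟩, ?_⟩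
  rw [hd']
  have hc0 : c ≠ 0 := hc.1.ne'
  simp only [neg_smul, zero_smul, neg_zero, add_zero, ← sub_eq_add_neg] at hc'
  have h3 : f (x + r • e) + f (x - r • e) - 2 * f x
      = (r ^ 2 * (g (x + c • e) - g (x - c • e))) / (2 * c) := by
    rw [eq_div_iff (by positivity)]
    nlinarith [hc']
  rw [h3, neg_smul, ← sub_eq_add_neg, sub_neg_eq_add, ← two_mul, mul_div_assoc]

theorem secondDiff_approx {f : Euc n → ℝ} (hf : ContDiff ℝ 2 f) (ρ : ℝ) {ε : ℝ} (hε : 0 < ε) :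
    ∃ δ > 0, ∀ r, 0 < r → r < δ → ∀ x, ‖x‖ ≤ ρ →
      |secondDiff r f x - r ^ 2 * lap f x| ≤ ε * r ^ 2 := by
  have hone : ∀ i : Fin n, ∃ δ > 0, ∀ r, 0 < r → r < δ → ∀ x, ‖x‖ ≤ ρ →
      |(f (x + r • stdVec i) + f (x - r • stdVec i) - 2 * f x)
        - r ^ 2 * fderiv ℝ (fun y => fderiv ℝ f y (stdVec i)) x (stdVec i)|
      ≤ ε / (n + 1) * r ^ 2 := by
    intro i
    have huc := (isCompact_closedBall (0 : Euc n) (ρ + 1)).uniformContinuousOn_of_continuous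
      (continuous_fderiv_fderiv_apply hf (stdVec i)).continuousOn
    obtain ⟨δ, hδ, h⟩ := Metric.uniformContinuousOn_iff.1 huc (ε / (n + 1)) (by positivity)
    refine ⟨min δ 1, by positivity, fun r hr hrδ x hx => ?_⟩
    obtain ⟨t, ht, heq⟩ := exists_second_difference_eq hf x (stdVec i) hr
    have hnt : ‖t • (stdVec i : Euc n)‖ ≤ r := by
      simpa [stdVec, norm_smul] using ht
    rw [heq, ← mul_sub, abs_mul, abs_of_nonneg (sq_nonneg r), mul_comm]
    refine mul_le_mul_of_nonneg_right ?_ (sq_nonneg r)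
    have := h (x + t • stdVec i) ?_ x ?_ ?_
    · rw [Real.dist_eq] at this
      exact this.le
    · rw [mem_closedBall_zero_iff]
      exact (norm_add_le _ _).trans (add_le_add hx (hnt.trans (hrδ.le.trans (min_le_right _ _))))
    · rw [mem_closedBall_zero_iff]
      linarith
    · rw [dist_eq_norm, add_sub_cancel_left]
      exact hnt.trans_lt (hrδ.trans_le (min_le_left _ _))
  choose δ hδ h using hone
  obtain ⟨d, hd, hdle⟩ : ∃ d > 0, ∀ i, d ≤ δ i := by
    rcases isEmpty_or_nonempty (Fin n) with he | he
    · exact ⟨1, one_pos, fun i => he.elim i⟩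
    · obtain ⟨j, hj⟩ := Finite.exists_min δ
      exact ⟨δ j, hδ j, hj⟩
  refine ⟨d, hd, fun r hr hrd x hx => ?_⟩
  rw [secondDiff, lap, Finset.mul_sum, ← Finset.sum_sub_distrib]
  refine (Finset.abs_sum_le_sum_abs _ _).trans ((Finset.sum_le_sum fun i _ =>
    h i r hr (hrd.trans_le (hdle i)) x hx).trans ?_)
  simp only [Finset.sum_const, Finset.card_univ, Fintype.card_fin, nsmul_eq_mul]
  rw [← mul_assoc]
  refine mul_le_mul_of_nonneg_right ?_ (sq_nonneg r)
  rw [mul_div_assoc', div_le_iff₀ (by positivity)]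
  nlinarith

theorem lap_nonneg_of_isLocalMin {f : Euc n → ℝ} (hf : ContDiff ℝ 2 f) {x : Euc n}
    (hx : IsLocalMin f x) : 0 ≤ lap f x := by
  by_contra! hneg
  obtain ⟨δ, hδ, h⟩ := secondDiff_approx hf ‖x‖ (ε := -lap f x / 2) (by linarith)
  obtain ⟨d, hd, hball⟩ := Metric.eventually_nhds_iff.1 hx
  obtain ⟨r, hr, hrlt⟩ := exists_between (lt_min hδ hd)
  have h1 := (abs_le.1 (h r hr (hrlt.trans_le (min_le_left _ _)) x le_rfl)).2
  have h2 : 0 ≤ secondDiff r f x := by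
    refine Finset.sum_nonneg fun i _ => ?_
    have hn : ‖r • (stdVec i : Euc n)‖ < d := by
      simpa [stdVec, norm_smul, abs_of_pos hr] using hrlt.trans_le (min_le_right _ _)
    have h3 := hball (y := x + r • stdVec i) (by simpa [dist_eq_norm] using hn)
    have h4 := hball (y := x - r • stdVec i) (by simpa [dist_eq_norm] using hn)
    linarith
  nlinarith [sq_pos_of_pos hr]

end

section

open scoped Topology ContDiff
variable {n : ℕ}

theorem secondDiff_eq_sum_sub (r : ℝ) (f : Euc n → ℝ) (x : Euc n) :
    secondDiff r f x = ∑ i, (f (x + r • stdVec i) + f (x - r • stdVec i)) - 2 * n * f x := by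
  simp only [secondDiff, Finset.sum_sub_distrib, Finset.sum_const, Finset.card_univ,
    Fintype.card_fin, nsmul_eq_mul]
  ring

theorem secondDiff_add_mul (r ε : ℝ) (f g : Euc n → ℝ) (x : Euc n) :
    secondDiff r (fun y => f y + ε * g y) x = secondDiff r f x + ε * secondDiff r g x := by
  simp only [secondDiff, Finset.mul_sum, ← Finset.sum_add_distrib]
  exact Finset.sum_congr rfl fun i _ => by ring

/-- A nonnegative truncated paraboloid. -/
noncomputable def truncParab (ρ : ℝ) (x : Euc n) : ℝ := max ((ρ + 1) ^ 2 - ‖x‖ ^ 2) 0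

theorem truncParab_nonneg (ρ : ℝ) (x : Euc n) : 0 ≤ truncParab ρ x := le_max_right _ _

theorem truncParab_le (ρ : ℝ) (x : Euc n) : truncParab ρ x ≤ (ρ + 1) ^ 2 :=
  max_le (sub_le_self _ (sq_nonneg _)) (sq_nonneg _)

theorem continuous_truncParab (ρ : ℝ) : Continuous (truncParab (n := n) ρ) := by
  unfold truncParab
  fun_prop

theorem secondDiff_truncParab {ρ r : ℝ} (hr : 0 < r) (hr1 : r ≤ 1) {x : Euc n} (hx : ‖x‖ < ρ) :
    secondDiff r (truncParab ρ) x = -(2 * n * r ^ 2) := by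
  have hval : ∀ y : Euc n, ‖y‖ ≤ ρ + 1 → truncParab ρ y = (ρ + 1) ^ 2 - ‖y‖ ^ 2 := fun y hy =>
    max_eq_left (sub_nonneg.2 (pow_le_pow_left₀ (norm_nonneg _) hy 2))
  have hterm : ∀ i : Fin n, truncParab ρ (x + r • stdVec i) + truncParab ρ (x - r • stdVec i)
      - 2 * truncParab ρ x = -(2 * r ^ 2) := by
    intro i
    have hn : ‖r • (stdVec i : Euc n)‖ = r := by simp [stdVec, norm_smul, abs_of_pos hr]
    rw [hval _ ((norm_add_le _ _).trans (by linarith)),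
      hval _ ((norm_sub_le _ _).trans (by linarith)), hval x (by linarith)]
    have := parallelogram_law_with_norm ℝ x (r • (stdVec i : Euc n))
    rw [hn] at this
    nlinarith
  rw [secondDiff, Finset.sum_congr rfl fun i _ => hterm i]
  simp
  ring

/-- Existence of a discrete solution between a (perturbed) sub- and supersolution, by monotone
iteration. -/
theorem exists_discrete_solution (hn : 0 < n) {c : ℝ} (hc : 0 < c) {R φ ψ : Euc n → ℝ}
    (hRc : Continuous R) (hR : ∀ x, 0 ≤ R x) (hφ : ContDiff ℝ 2 φ) (hψ : ContDiff ℝ 2 ψ)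
    (hφpos : ∀ x, 0 < φ x) (hψφ : ∀ x, ψ x ≤ φ x)
    (hsuper : ∀ x, c * lap φ x ≤ R x * φ x) (hsub : ∀ x, R x * ψ x ≤ c * lap ψ x)
    {ρ τ : ℝ} (hρ : 0 < ρ) (hτ : 0 < τ) :
    ∃ r, 0 < r ∧ r < τ ∧ r < 1 ∧ ∃ w : Euc n → ℝ, Measurable w ∧
      (∀ x, 0 ≤ w x ∧ w x ≤ φ x + τ ∧ ψ x - τ ≤ w x) ∧
      ∀ x, ‖x‖ < ρ → c * secondDiff r w x = r ^ 2 * (R x * w x) := by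
  set ε : ℝ := τ / (ρ + 1) ^ 2 with hεdef
  have hε : 0 < ε := by positivity
  obtain ⟨δ₁, hδ₁, h₁⟩ := secondDiff_approx hφ ρ hε
  obtain ⟨δ₂, hδ₂, h₂⟩ := secondDiff_approx hψ ρ hε
  obtain ⟨r, hr, hrlt⟩ := exists_between (lt_min (lt_min hδ₁ hδ₂) (lt_min hτ one_pos))
  have hrδ₁ : r < δ₁ := hrlt.trans_le ((min_le_left _ _).trans (min_le_left _ _))
  have hrδ₂ : r < δ₂ := hrlt.trans_le ((min_le_left _ _).trans (min_le_right _ _))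
  have hrτ : r < τ := hrlt.trans_le ((min_le_right _ _).trans (min_le_left _ _))
  have hr1 : r < 1 := hrlt.trans_le ((min_le_right _ _).trans (min_le_right _ _))
  refine ⟨r, hr, hrτ, hr1, ?_⟩
  have hn1 : (1 : ℝ) ≤ n := by exact_mod_cast hn
  have hr2 : 0 < r ^ 2 := by positivity
  have hεp : ∀ x : Euc n, 0 ≤ ε * truncParab ρ x ∧ ε * truncParab ρ x ≤ τ := fun x =>
    ⟨mul_nonneg hε.le (truncParab_nonneg _ _), by
      refine (mul_le_mul_of_nonneg_left (truncParab_le ρ x) hε.le).trans_eq ?_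
      rw [hεdef]
      field_simp⟩
  set Φ : Euc n → ℝ := fun x => φ x + ε * truncParab ρ x with hΦ
  set Ψ₀ : Euc n → ℝ := fun x => ψ x + (-ε) * truncParab ρ x with hΨ₀
  set Ψ : Euc n → ℝ := fun x => max 0 (Ψ₀ x) with hΨ
  set D : Euc n → ℝ := fun x => 2 * n + r ^ 2 * R x / c with hD
  have hDpos : ∀ x, 0 < D x := fun x => by
    have : 0 ≤ r ^ 2 * R x / c := by have := hR x; positivity
    simp only [hD]
    linarith
  set S : (Euc n → ℝ) → Euc n → ℝ :=
    fun w x => ∑ i, (w (x + r • stdVec i) + w (x - r • stdVec i)) with hS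
  set T : (Euc n → ℝ) → Euc n → ℝ := fun w x => if ‖x‖ < ρ then S w x / D x else Φ x with hT
  have hSmono : ∀ {u v : Euc n → ℝ}, (∀ x, u x ≤ v x) → ∀ x, S u x ≤ S v x := fun h x =>
    Finset.sum_le_sum fun i _ => add_le_add (h _) (h _)
  have hTmono : ∀ {u v : Euc n → ℝ}, (∀ x, u x ≤ v x) → ∀ x, T u x ≤ T v x := by
    intro u v h x
    simp only [hT]
    split_ifs
    · exact div_le_div_of_nonneg_right (hSmono h x) (hDpos x).le
    · exact le_rfl
  have hΦpos : ∀ x, 0 < Φ x := fun x => by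
    have := hφpos x
    have := (hεp x).1
    simp only [hΦ]
    linarith
  have hTΦ : ∀ x, T Φ x ≤ Φ x := by
    intro x
    simp only [hT]
    split_ifs with hx
    · rw [div_le_iff₀ (hDpos x)]
      have e1 := secondDiff_eq_sum_sub r Φ x
      have e2 := secondDiff_add_mul r ε φ (truncParab ρ) x
      rw [secondDiff_truncParab hr hr1.le hx] at e2
      have e3 := (abs_le.1 (h₁ r hr hrδ₁ x hx.le)).2
      have e4 : r ^ 2 * lap φ x ≤ r ^ 2 * R x / c * Φ x := by
        rw [div_mul_eq_mul_div, le_div_iff₀ hc]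
        have := mul_le_mul_of_nonneg_left (hsuper x) hr2.le
        have := mul_nonneg (mul_nonneg hr2.le (hR x)) (hεp x).1
        simp only [hΦ]
        nlinarith
      have e5 : ε * r ^ 2 ≤ ε * r ^ 2 * (2 * n) := by
        have : 0 < ε * r ^ 2 := by positivity
        nlinarith
      simp only [hS, hD]
      linarith
    · exact le_rfl
  have hTΨ : ∀ x, Ψ x ≤ T Ψ x := by
    intro x
    simp only [hT]
    split_ifs with hx
    · refine max_le (div_nonneg (Finset.sum_nonneg fun i _ =>
        add_nonneg (le_max_left _ _) (le_max_left _ _)) (hDpos x).le) ?_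
      rw [le_div_iff₀ (hDpos x)]
      refine le_trans ?_ (hSmono (u := Ψ₀) (fun x => le_max_right _ _) x)
      have e1 := secondDiff_eq_sum_sub r Ψ₀ x
      have e2 := secondDiff_add_mul r (-ε) ψ (truncParab ρ) x
      rw [secondDiff_truncParab hr hr1.le hx] at e2
      have e3 := (abs_le.1 (h₂ r hr hrδ₂ x hx.le)).1
      have e4 : r ^ 2 * R x / c * Ψ₀ x ≤ r ^ 2 * lap ψ x := by
        rw [div_mul_eq_mul_div, div_le_iff₀ hc]
        have := mul_le_mul_of_nonneg_left (hsub x) hr2.le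
        have := mul_nonneg (mul_nonneg hr2.le (hR x)) (hεp x).1
        simp only [hΨ₀]
        nlinarith
      have e5 : ε * r ^ 2 ≤ ε * r ^ 2 * (2 * n) := by
        have : 0 < ε * r ^ 2 := by positivity
        nlinarith
      simp only [hS, hD]
      linarith
    · refine max_le (hΦpos x).le ?_
      have := hψφ x
      have := (hεp x).1
      simp only [hΨ₀, hΦ]
      linarith
  have hΨΦ : ∀ x, Ψ x ≤ Φ x := fun x => max_le (hΦpos x).le (by
    have := hψφ x
    have := (hεp x).1
    simp only [hΨ₀, hΦ]
    linarith)
  have hΦm : Measurable Φ :=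
    (hφ.continuous.add (continuous_const.mul (continuous_truncParab ρ))).measurable
  set W : ℕ → Euc n → ℝ := fun j => T^[j] Φ with hW
  have hWsucc : ∀ j, W (j + 1) = T (W j) := fun j => Function.iterate_succ_apply' T j Φ
  have hWlow : ∀ j x, Ψ x ≤ W j x := by
    intro j
    induction j with
    | zero => exact hΨΦ
    | succ j ih =>
      intro x
      rw [hWsucc]
      exact (hTΨ x).trans (hTmono ih x)
  have hWstep : ∀ j x, W (j + 1) x ≤ W j x := by
    intro j
    induction j with
    | zero => exact hTΦ
    | succ j ih =>
      intro x
      rw [hWsucc (j + 1)]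
      nth_rewrite 2 [hWsucc j]
      exact hTmono ih x
  have hWm : ∀ j, Measurable (W j) := by
    intro j
    induction j with
    | zero => exact hΦm
    | succ j ih =>
      rw [hWsucc]
      refine Measurable.ite (measurableSet_lt measurable_norm measurable_const) ?_ hΦm
      refine Measurable.div (Finset.measurable_sum _ fun i _ => ?_) ?_
      · exact (ih.comp (measurable_id.add_const _)).add (ih.comp (measurable_id.sub_const _))
      · have := hRc.measurable
        simp only [hD]
        fun_prop
  have hanti : ∀ x, Antitone fun j => W j x := fun x => antitone_nat_of_succ_le fun j => hWstep j x
  have hbdd : ∀ x, BddBelow (Set.range fun j => W j x) := fun x =>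
    ⟨Ψ x, by rintro _ ⟨j, rfl⟩; exact hWlow j x⟩
  set w : Euc n → ℝ := fun x => ⨅ j, W j x with hw
  have hlim : ∀ x, Tendsto (fun j => W j x) atTop (𝓝 (w x)) := fun x =>
    tendsto_atTop_ciInf (hanti x) (hbdd x)
  have hwlow : ∀ x, Ψ x ≤ w x := fun x => ge_of_tendsto' (hlim x) fun j => hWlow j x
  refine ⟨w, measurable_of_tendsto_metrizable hWm (tendsto_pi_nhds.2 hlim), fun x =>
    ⟨(le_max_left _ _).trans (hwlow x), ?_, ?_⟩, fun x hx => ?_⟩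
  · refine (ciInf_le (hbdd x) 0).trans ?_
    have := (hεp x).2
    change Φ x ≤ _
    simp only [hΦ]
    linarith
  · refine le_trans ?_ ((le_max_right _ _).trans (hwlow x))
    have := (hεp x).2
    simp only [hΨ₀]
    linarith
  · have hfix : w x = S w x / D x := by
      refine tendsto_nhds_unique ((hlim x).comp (tendsto_add_atTop_nat 1)) ?_
      have h3 : ((fun j => W j x) ∘ fun j => j + 1) = fun j => S (W j) x / D x := by
        funext j
        simp only [Function.comp, hWsucc, hT, if_pos hx]
      rw [h3]
      exact (tendsto_finsetSum _ fun i _ => (hlim _).add (hlim _)).div_const _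
    have h4 : S w x = w x * D x := by rw [hfix]; field_simp [(hDpos x).ne']
    rw [secondDiff_eq_sum_sub]
    change c * (S w x - _) = _
    rw [h4]
    simp only [hD]
    field_simp
    ring

end

section

open Filter MeasureTheory
open scoped Topology ContDiff
variable {n : ℕ}

theorem exists_bounded_weak_limit {α : Type*} [MeasurableSpace α] {μ : Measure α} [SigmaFinite μ]
    {d : α → ℝ} (hd : MemLp d 2 μ) (hdm : Measurable d) (hd0 : ∀ x, 0 ≤ d x)
    {h : ℕ → α → ℝ} (hm : ∀ k, Measurable (h k)) (hb : ∀ k x, |h k x| ≤ d x) (U : Ultrafilter ℕ) :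
    ∃ g : α → ℝ, Measurable g ∧ (∀ x, |g x| ≤ d x) ∧ ∀ f : α → ℝ, MemLp f 2 μ →
      Tendsto (fun k => ∫ x, f x * h k x ∂μ) U (𝓝 (∫ x, f x * g x ∂μ)) := by
  have hL : ∀ k, MemLp (h k) 2 μ := fun k =>
    hd.mono (hm k).aestronglyMeasurable (.of_forall fun x => by
      simpa [Real.norm_eq_abs, abs_of_nonneg (hd0 x)] using hb k x)
  let H : ℕ → Lp ℝ 2 μ := fun k => (hL k).toLp
  have hH : ∀ k, ‖H k‖ ≤ ‖hd.toLp‖ := fun k => by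
    apply Lp.norm_le_norm_of_ae_le
    filter_upwards [(hL k).coeFn_toLp, hd.coeFn_toLp] with x h1 h2
    simpa [H, h1, h2, abs_of_nonneg (hd0 x)] using hb k x
  let T : ℕ → WeakDual ℝ (Lp ℝ 2 μ) := fun k =>
    StrongDual.toWeakDual (InnerProductSpace.toDual ℝ (Lp ℝ 2 μ) (H k))
  obtain ⟨t, -, ht⟩ := (WeakDual.isCompact_closedBall (𝕜 := ℝ) (E := Lp ℝ 2 μ) 0
    ‖hd.toLp‖).ultrafilter_le_nhds (U.map T) (by
      rw [Filter.le_principal_iff]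
      refine Filter.mem_map.2 (Filter.univ_mem' fun k => ?_)
      simpa [T] using hH k)
  have ht' : Tendsto T U (𝓝 t) := ht
  obtain ⟨G, hG⟩ := (InnerProductSpace.toDual ℝ (Lp ℝ 2 μ)).surjective (WeakDual.toStrongDual t)
  have key : ∀ f : α → ℝ, MemLp f 2 μ →
      Tendsto (fun k => ∫ x, f x * h k x ∂μ) U (𝓝 (∫ x, f x * G x ∂μ)) := by
    intro f hf
    have h1 := tendsto_iff_forall_eval_tendsto_topDualPairing.1 ht' hf.toLp
    have e1 : ∀ k, topDualPairing ℝ (Lp ℝ 2 μ) (T k) hf.toLp = ∫ x, f x * h k x ∂μ := by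
      intro k
      change inner ℝ (H k) hf.toLp = _
      rw [L2.inner_def]
      apply integral_congr_ae
      filter_upwards [(hL k).coeFn_toLp, hf.coeFn_toLp] with x h1 h2
      simp [H, h1, h2]
    have e2 : topDualPairing ℝ (Lp ℝ 2 μ) t hf.toLp = ∫ x, f x * G x ∂μ := by
      change WeakDual.toStrongDual t hf.toLp = _
      rw [← hG]
      change inner ℝ G hf.toLp = _
      rw [L2.inner_def]
      apply integral_congr_ae
      filter_upwards [hf.coeFn_toLp] with x h2
      simp [h2]
    simpa only [e1, e2] using h1
  have hGL : MemLp (G : α → ℝ) 2 μ := Lp.memLp G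
  have hint : ∀ {u : α → ℝ}, MemLp u 2 μ → ∀ s, MeasurableSet s → μ s < ⊤ → IntegrableOn u s μ := by
    intro u hu s _ hs'
    have : IsFiniteMeasure (μ.restrict s) := ⟨by simpa using hs'⟩
    exact (hu.restrict s).integrable (by norm_num)
  have hset : ∀ s, MeasurableSet s → μ s < ⊤ →
      Tendsto (fun k => ∫ x in s, h k x ∂μ) U (𝓝 (∫ x in s, G x ∂μ)) := by
    intro s hs hs'
    have h1 := key (s.indicator fun _ => (1 : ℝ)) (memLp_indicator_const 2 hs 1 (Or.inr hs'.ne))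
    have e : ∀ u : α → ℝ, ∫ x, s.indicator (fun _ => (1 : ℝ)) x * u x ∂μ = ∫ x in s, u x ∂μ := by
      intro u
      rw [← integral_indicator hs]
      congr 1
      ext x
      by_cases hx : x ∈ s <;> simp [hx]
    simpa only [e] using h1
  have up : ∀ᵐ x ∂μ, 0 ≤ d x - G x := by
    refine ae_nonneg_of_forall_setIntegral_nonneg_of_sigmaFinite (hint (hd.sub hGL)) ?_
    intro s hs hs'
    rw [integral_sub (hint hd s hs hs') (hint hGL s hs hs')]
    refine sub_nonneg.2 (le_of_tendsto (hset s hs hs') (.of_forall fun k => ?_))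
    exact integral_mono (hint (hL k) s hs hs') (hint hd s hs hs') fun x => (abs_le.1 (hb k x)).2
  have lo : ∀ᵐ x ∂μ, 0 ≤ G x + d x := by
    refine ae_nonneg_of_forall_setIntegral_nonneg_of_sigmaFinite (hint (hGL.add hd)) ?_
    intro s hs hs'
    rw [integral_add (hint hGL s hs hs') (hint hd s hs hs')]
    have : -∫ x in s, d x ∂μ ≤ ∫ x in s, G x ∂μ := by
      refine ge_of_tendsto (hset s hs hs') (.of_forall fun k => ?_)
      rw [← integral_neg]
      exact integral_mono (hint hd s hs hs').neg (hint (hL k) s hs hs')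
        fun x => (abs_le.1 (hb k x)).1
    linarith
  have hGm : Measurable (G : α → ℝ) := (Lp.stronglyMeasurable G).measurable
  refine ⟨fun x => max (-d x) (min (G x) (d x)), by fun_prop, fun x => ?_, fun f hf => ?_⟩
  · rw [abs_le]
    exact ⟨le_max_left _ _, max_le (by linarith [hd0 x]) (min_le_right _ _)⟩
  · convert key f hf using 2
    apply integral_congr_ae
    filter_upwards [up, lo] with x h1 h2
    rw [min_eq_left (by linarith), max_eq_right (by linarith)]

theorem lap_congr {f g : Euc n → ℝ} {x : Euc n} (h : f =ᶠ[𝓝 x] g) : lap f x = lap g x := by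
  unfold lap
  refine Finset.sum_congr rfl fun i _ => ?_
  have : (fun y => fderiv ℝ f y (stdVec i)) =ᶠ[𝓝 x] fun y => fderiv ℝ g y (stdVec i) :=
    (h.fderiv (𝕜 := ℝ)).mono fun y hy => by simp only [hy]
  exact congrArg (fun L : Euc n →L[ℝ] ℝ => L (stdVec i)) this.fderiv_eq

theorem lap_eq_zero_of_notMem_tsupport {f : Euc n → ℝ} {x : Euc n} (hx : x ∉ tsupport f) :
    lap f x = 0 := by
  rw [lap_congr (notMem_tsupport_iff_eventuallyEq.1 hx)]
  simp [lap]

theorem hasCompactSupport_lap {f : Euc n → ℝ} (hf : HasCompactSupport f) :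
    HasCompactSupport (lap f) :=
  HasCompactSupport.intro hf fun _ hx => lap_eq_zero_of_notMem_tsupport hx

theorem integrable_mul_of_abs_le {ψ w b : Euc n → ℝ} (hψ : Continuous ψ)
    (hs : HasCompactSupport ψ) (hb : Continuous b) (hw : Measurable w) (hwb : ∀ x, |w x| ≤ b x) :
    Integrable fun x => ψ x * w x := by
  have h : Integrable fun x => ψ x * b x :=
    (hψ.mul hb).integrable_of_hasCompactSupport hs.mul_right
  refine h.mono (hψ.measurable.mul hw).aestronglyMeasurable (.of_forall fun x => ?_)
  simp only [norm_mul, Real.norm_eq_abs]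
  exact mul_le_mul_of_nonneg_left ((hwb x).trans (le_abs_self _)) (abs_nonneg _)

theorem integral_mul_secondDiff {ψ w b : Euc n → ℝ} (hψ : Continuous ψ)
    (hs : HasCompactSupport ψ) (hb : Continuous b) (hw : Measurable w) (hwb : ∀ x, |w x| ≤ b x)
    (r : ℝ) : ∫ x, ψ x * secondDiff r w x = ∫ x, secondDiff r ψ x * w x := by
  have hsh : ∀ u : Euc n, HasCompactSupport fun x => ψ (x + u) := fun u =>
    hs.comp_homeomorph (Homeomorph.addRight u)
  have i1 : ∀ u : Euc n, Integrable fun x => ψ x * w (x + u) := fun u =>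
    integrable_mul_of_abs_le hψ hs (b := fun x => b (x + u)) (by fun_prop)
      (w := fun x => w (x + u)) (by fun_prop) fun x => hwb _
  have i2 : ∀ u : Euc n, Integrable fun x => ψ (x + u) * w x := fun u =>
    integrable_mul_of_abs_le (ψ := fun x => ψ (x + u)) (by fun_prop) (hsh u) hb hw hwb
  have tr : ∀ u : Euc n, ∫ x, ψ x * w (x + u) = ∫ x, ψ (x - u) * w x := fun u => by
    rw [← integral_add_right_eq_self (fun x => ψ (x - u) * w x) u]
    simp
  have i0 := integrable_mul_of_abs_le hψ hs hb hw hwb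
  have j1 : ∀ u : Euc n, Integrable fun x => ψ x * w (x - u) := fun u => by
    simpa [sub_eq_add_neg] using i1 (-u)
  have j2 : ∀ u : Euc n, Integrable fun x => ψ (x - u) * w x := fun u => by
    simpa [sub_eq_add_neg] using i2 (-u)
  have tr' : ∀ u : Euc n, ∫ x, ψ x * w (x - u) = ∫ x, ψ (x + u) * w x := fun u => by
    simpa [sub_eq_add_neg] using tr (-u)
  have k1 : ∀ u : Euc n, Integrable fun x => ψ x * w (x + u) + ψ x * w (x - u) :=
    fun u => (i1 u).add (j1 u)
  have k2 : ∀ u : Euc n, Integrable fun x => ψ (x + u) * w x + ψ (x - u) * w x :=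
    fun u => (i2 u).add (j2 u)
  have e1 : ∀ x, ψ x * secondDiff r w x = ∑ i, (ψ x * w (x + r • stdVec i)
      + ψ x * w (x - r • stdVec i) - 2 * (ψ x * w x)) := fun x => by
    rw [secondDiff, Finset.mul_sum]
    exact Finset.sum_congr rfl fun i _ => by ring
  have e2 : ∀ x, secondDiff r ψ x * w x = ∑ i, (ψ (x + r • stdVec i) * w x
      + ψ (x - r • stdVec i) * w x - 2 * (ψ x * w x)) := fun x => by
    rw [secondDiff, Finset.sum_mul]
    exact Finset.sum_congr rfl fun i _ => by ring
  simp only [e1, e2]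
  rw [integral_finsetSum, integral_finsetSum]
  · refine Finset.sum_congr rfl fun i _ => ?_
    rw [integral_sub (k1 _) (i0.const_mul 2),
      integral_sub (k2 _) (i0.const_mul 2), integral_add (i1 _) (j1 _),
      integral_add (i2 _) (j2 _), tr, tr']
    ring
  · exact fun i _ => (k2 _).sub (i0.const_mul 2)
  · exact fun i _ => (k1 _).sub (i0.const_mul 2)

theorem exists_locally_bounded_weak_limit {b : Euc n → ℝ} (hb : Continuous b) (hb0 : ∀ x, 0 < b x)
    {h : ℕ → Euc n → ℝ} (hm : ∀ k, Measurable (h k)) (hh : ∀ k x, |h k x| ≤ b x)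
    (U : Ultrafilter ℕ) :
    ∃ g : Euc n → ℝ, Measurable g ∧ (∀ x, |g x| ≤ b x) ∧ ∀ ψ : Euc n → ℝ, Continuous ψ →
      HasCompactSupport ψ → Tendsto (fun k => ∫ x, ψ x * h k x) U (𝓝 (∫ x, ψ x * g x)) := by
  let d : Euc n → ℝ := fun x => (1 + ‖x‖) ^ (-((n : ℝ) + 1))
  have hdpos : ∀ x, 0 < d x := fun x => Real.rpow_pos_of_pos (by positivity) _
  have hdc : Continuous d := by
    refine Continuous.rpow_const (by fun_prop) fun x => Or.inl (by positivity)
  have hd1 : ∀ x, d x ≤ 1 := fun x =>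
    Real.rpow_le_one_of_one_le_of_nonpos (by linarith [norm_nonneg x]) (by
      have : (0 : ℝ) ≤ n := Nat.cast_nonneg n
      linarith)
  have hdi : Integrable d := integrable_one_add_norm (by simp)
  have hd2 : MemLp d 2 := by
    rw [memLp_two_iff_integrable_sq hdc.aestronglyMeasurable]
    refine hdi.mono (hdc.pow 2).aestronglyMeasurable (.of_forall fun x => ?_)
    rw [Real.norm_of_nonneg (by positivity), Real.norm_of_nonneg (hdpos x).le]
    nlinarith [hdpos x, hd1 x]
  obtain ⟨g, hgm, hgb, hg⟩ := exists_bounded_weak_limit hd2 hdc.measurable (fun x => (hdpos x).le)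
    (h := fun k x => d x / b x * h k x)
    (fun k => (hdc.measurable.div hb.measurable).mul (hm k)) (fun k x => by
      rw [abs_mul, abs_div, abs_of_pos (hdpos x), abs_of_pos (hb0 x), div_mul_eq_mul_div,
        div_le_iff₀ (hb0 x)]
      exact mul_le_mul_of_nonneg_left (hh k x) (hdpos x).le) U
  refine ⟨fun x => b x / d x * g x, (hb.measurable.div hdc.measurable).mul hgm, fun x => ?_, ?_⟩
  · rw [abs_mul, abs_div, abs_of_pos (hdpos x), abs_of_pos (hb0 x), div_mul_eq_mul_div,
        div_le_iff₀ (hdpos x)]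
    exact mul_le_mul_of_nonneg_left (hgb x) (hb0 x).le
  · intro ψ hψ hs
    have := hg (fun x => ψ x * (b x / d x))
      ((hψ.mul (hb.div hdc fun x => (hdpos x).ne')).memLp_of_hasCompactSupport hs.mul_right)
    convert this using 4 with k x x
    · have := (hdpos x).ne'
      have := (hb0 x).ne'
      field_simp
    · ring

theorem norm_stdVec (i : Fin n) : ‖stdVec i‖ = 1 := by simp

theorem secondDiff_eq_zero {f : Euc n → ℝ} {ρ r : ℝ} (hf : ∀ x, ρ < ‖x‖ → f x = 0) (hr : 0 < r)
    {x : Euc n} (hx : ρ + r < ‖x‖) : secondDiff r f x = 0 := by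
  unfold secondDiff
  refine Finset.sum_eq_zero fun i _ => ?_
  have hn : ‖r • stdVec i‖ = r := by rw [norm_smul, norm_stdVec, Real.norm_of_nonneg hr.le, mul_one]
  have h1 : ‖x‖ ≤ ‖x + r • stdVec i‖ + r := by
    simpa [hn] using norm_sub_le (x + r • stdVec i) (r • stdVec i)
  have h2 : ‖x‖ ≤ ‖x - r • stdVec i‖ + r := by
    simpa [hn] using norm_add_le (x - r • stdVec i) (r • stdVec i)
  rw [hf _ (by linarith), hf _ (by linarith), hf _ (by linarith)]
  ring

theorem continuous_secondDiff {f : Euc n → ℝ} (hf : Continuous f) (r : ℝ) :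
    Continuous (secondDiff r f) := by
  unfold secondDiff
  fun_prop

theorem tendsto_integral_secondDiff {l : Filter ℕ} {ψ b : Euc n → ℝ} (hψ : ContDiff ℝ 2 ψ)
    (hs : HasCompactSupport ψ) (hb : Continuous b) {h : ℕ → Euc n → ℝ}
    (hm : ∀ k, Measurable (h k)) (hh : ∀ k x, |h k x| ≤ b x) {r : ℕ → ℝ} (hr : ∀ k, 0 < r k)
    (hr0 : Tendsto r l (𝓝 0)) {I : ℝ} (hI : Tendsto (fun k => ∫ x, lap ψ x * h k x) l (𝓝 I)) :
    Tendsto (fun k => ∫ x, (secondDiff (r k) ψ x / r k ^ 2) * h k x) l (𝓝 I) := by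
  obtain ⟨ρ, hρ, hsub⟩ := hs.isCompact.isBounded.subset_closedBall_lt 0 0
  have hz : ∀ x, ρ < ‖x‖ → ψ x = 0 := fun x hx => image_eq_zero_of_notMem_tsupport fun h' => by
    have := hsub h'
    rw [mem_closedBall_zero_iff] at this
    linarith
  have hlz : ∀ x, ρ < ‖x‖ → lap ψ x = 0 := fun x hx => lap_eq_zero_of_notMem_tsupport fun h' => by
    have := hsub h'
    rw [mem_closedBall_zero_iff] at this
    linarith
  set B := Metric.closedBall (0 : Euc n) (ρ + 1)
  have hBi : Integrable (B.indicator b) :=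
    (integrable_indicator_iff Metric.isClosed_closedBall.measurableSet).2
      (hb.continuousOn.integrableOn_compact (isCompact_closedBall _ _))
  have hb0 : ∀ x, 0 ≤ b x := fun x => (abs_nonneg _).trans (hh 0 x)
  set M := ∫ x, B.indicator b x
  have hM : 0 ≤ M := integral_nonneg fun x => Set.indicator_nonneg (fun x _ => hb0 x) x
  have hd : Tendsto (fun k => (∫ x, (secondDiff (r k) ψ x / r k ^ 2) * h k x)
      - ∫ x, lap ψ x * h k x) l (𝓝 0) := by
    rw [Metric.tendsto_nhds]
    intro ε hε
    obtain ⟨δ, hδ, H⟩ := secondDiff_approx hψ (ρ + 1) (ε := ε / (M + 1)) (by positivity)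
    have e0 := hr0.eventually (gt_mem_nhds hδ)
    have e1 := hr0.eventually (gt_mem_nhds one_pos)
    filter_upwards [e0, e1] with k hk hk1
    have hrk := hr k
    have hcs : HasCompactSupport fun x => secondDiff (r k) ψ x / r k ^ 2 := by
      refine HasCompactSupport.intro (isCompact_closedBall (0 : Euc n) (ρ + 1)) fun x hx => ?_
      rw [mem_closedBall_zero_iff, not_le] at hx
      rw [secondDiff_eq_zero hz hrk (by linarith), zero_div]
    rw [← integral_sub
      (integrable_mul_of_abs_le ((continuous_secondDiff hψ.continuous _).div_const _) hcs hb (hm k)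
        (hh k))
      (integrable_mul_of_abs_le (continuous_lap hψ) (hasCompactSupport_lap hs) hb (hm k) (hh k)),
      dist_zero_right]
    have := norm_integral_le_of_norm_le (hBi.const_mul (ε / (M + 1)))
      (f := fun x => secondDiff (r k) ψ x / r k ^ 2 * h k x - lap ψ x * h k x)
      (.of_forall fun x => by
        rw [← sub_mul, norm_mul, Real.norm_eq_abs, Real.norm_eq_abs]
        by_cases hx : x ∈ B
        · rw [Set.indicator_of_mem hx]
          refine mul_le_mul ?_ (hh k x) (abs_nonneg _) (by positivity)
          have h1 := H _ hrk hk x (mem_closedBall_zero_iff.1 hx)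
          have h2 : secondDiff (r k) ψ x / r k ^ 2 - lap ψ x
              = (secondDiff (r k) ψ x - r k ^ 2 * lap ψ x) / r k ^ 2 := by
            field_simp
          rw [h2, abs_div, abs_of_pos (by positivity : 0 < r k ^ 2), div_le_iff₀ (by positivity)]
          exact h1
        · rw [Set.indicator_of_notMem hx]
          have hx' : ρ + 1 < ‖x‖ := by simpa [B] using hx
          rw [secondDiff_eq_zero hz hrk (by linarith), hlz x (by linarith)]
          simp)
    rw [integral_const_mul] at this
    refine this.trans_lt ?_
    change ε / (M + 1) * M < ε
    rw [div_mul_eq_mul_div, div_lt_iff₀ (by positivity)]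
    nlinarith
  simpa using hd.add hI

theorem exists_weak_solution (hn : 0 < n) {c : ℝ} (hc : 0 < c) {R φ v : Euc n → ℝ}
    (hRc : Continuous R) (hR : ∀ x, 0 ≤ R x) (hφ : ContDiff ℝ 2 φ) (hv : ContDiff ℝ 2 v)
    (hφpos : ∀ x, 0 < φ x) (hvφ : ∀ x, v x ≤ φ x) (hsuper : ∀ x, c * lap φ x ≤ R x * φ x)
    (hsub : ∀ x, R x * v x ≤ c * lap v x) :
    ∃ w : Euc n → ℝ, Measurable w ∧ (∀ x, |w x| ≤ φ x + 1) ∧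
      (∀ ψ : Euc n → ℝ, ContDiff ℝ 2 ψ → HasCompactSupport ψ →
        c * ∫ x, lap ψ x * w x = ∫ x, ψ x * (R x * w x)) ∧
      ∀ ψ : Euc n → ℝ, Continuous ψ → HasCompactSupport ψ → (∀ x, 0 ≤ ψ x) →
        0 ≤ ∫ x, ψ x * w x ∧ ∫ x, ψ x * w x ≤ ∫ x, ψ x * φ x ∧
          ∫ x, ψ x * v x ≤ ∫ x, ψ x * w x := by
  have hpos : ∀ k : ℕ, (0 : ℝ) < (k : ℝ) + 1 := fun k => by positivity
  choose r hr0 hrτ _ h hm hb hE using fun k : ℕ =>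
    exists_discrete_solution hn hc hRc hR hφ hv hφpos hvφ hsuper hsub (hpos k)
      (one_div_pos.2 (hpos k))
  have hτ1 : ∀ k : ℕ, 1 / ((k : ℝ) + 1) ≤ 1 := fun k => by
    rw [div_le_one (hpos k)]
    linarith [(Nat.cast_nonneg k : (0 : ℝ) ≤ k)]
  have hbc : Continuous fun x => φ x + 1 := hφ.continuous.add continuous_const
  have hh : ∀ k x, |h k x| ≤ φ x + 1 := fun k x => by
    obtain ⟨h1, h2, -⟩ := hb k x
    rw [abs_of_nonneg h1]
    linarith [hτ1 k]
  let U : Ultrafilter ℕ := Ultrafilter.of atTop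
  have hU : (U : Filter ℕ) ≤ atTop := Ultrafilter.of_le _
  have hτ : Tendsto (fun k : ℕ => 1 / ((k : ℝ) + 1)) U (𝓝 0) :=
    tendsto_one_div_add_atTop_nhds_zero_nat.mono_left hU
  have hr : Tendsto r U (𝓝 0) := squeeze_zero (fun k => (hr0 k).le) (fun k => (hrτ k).le) hτ
  obtain ⟨w, hwm, hwb, hw⟩ := exists_locally_bounded_weak_limit hbc
    (fun x => by linarith [hφpos x]) hm hh U
  refine ⟨w, hwm, hwb, fun ψ hψ hs => ?_, fun ψ hψ hs hψ0 => ?_⟩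
  · have t1 := (tendsto_integral_secondDiff hψ hs hbc hm hh hr0 hr
      (hw _ (continuous_lap hψ) (hasCompactSupport_lap hs))).const_mul c
    have t2 := hw (fun x => ψ x * R x) (hψ.continuous.mul hRc) hs.mul_right
    obtain ⟨ρ, -, hsub'⟩ := hs.isCompact.isBounded.subset_closedBall_lt 0 0
    have ev : ∀ᶠ k : ℕ in U, ∫ x, ψ x * R x * h k x
        = c * ∫ x, (secondDiff (r k) ψ x / r k ^ 2) * h k x := by
      refine ((tendsto_natCast_atTop_atTop (R := ℝ)).eventually_ge_atTop ρ).filter_mono hU |>.mono ?_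
      intro k hk
      have hrk := hr0 k
      have e1 : ∫ x, (secondDiff (r k) ψ x / r k ^ 2) * h k x
          = (∫ x, ψ x * secondDiff (r k) (h k) x) / r k ^ 2 := by
        rw [integral_mul_secondDiff hψ.continuous hs hbc (hm k) (hh k), ← integral_div]
        congr 1
        ext x
        ring
      rw [e1, mul_div_assoc', eq_div_iff (by positivity), ← integral_mul_const,
        ← integral_const_mul]
      congr 1
      ext x
      by_cases hx : x ∈ tsupport ψ
      · have hx' := hsub' hx
        rw [mem_closedBall_zero_iff] at hx'
        have := hE k x (by linarith)
        linear_combination - ψ x * this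
      · rw [image_eq_zero_of_notMem_tsupport hx]
        ring
    have := tendsto_nhds_unique (t2.congr' ev) t1
    rw [← this]
    simp only [mul_assoc]
  · have t := hw ψ hψ hs
    have hi := fun k => integrable_mul_of_abs_le hψ hs hbc (hm k) (hh k)
    have hψi : Integrable ψ := hψ.integrable_of_hasCompactSupport hs
    have hφi : Integrable fun x => ψ x * φ x :=
      (hψ.mul hφ.continuous).integrable_of_hasCompactSupport hs.mul_right
    have hvi : Integrable fun x => ψ x * v x :=
      (hψ.mul hv.continuous).integrable_of_hasCompactSupport hs.mul_right
    have tz : Tendsto (fun k : ℕ => (∫ x, ψ x) * (1 / ((k : ℝ) + 1))) U (𝓝 0) := by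
      simpa using hτ.const_mul (∫ x, ψ x)
    refine ⟨ge_of_tendsto t (.of_forall fun k => integral_nonneg fun x =>
      mul_nonneg (hψ0 x) (hb k x).1), ?_, ?_⟩
    · have t3 := tz.const_add (∫ x, ψ x * φ x)
      rw [add_zero] at t3
      refine le_of_tendsto_of_tendsto t t3 (.of_forall fun k => ?_)
      simp only
      rw [← integral_mul_const, ← integral_add hφi (hψi.mul_const _)]
      refine integral_mono (hi k) (hφi.add (hψi.mul_const _)) fun x => ?_
      have := mul_le_mul_of_nonneg_left (hb k x).2.1 (hψ0 x)
      simpa [mul_add] using this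
    · have t3 := tz.const_sub (∫ x, ψ x * v x)
      rw [sub_zero] at t3
      refine le_of_tendsto_of_tendsto t3 t (.of_forall fun k => ?_)
      simp only
      rw [← integral_mul_const, ← integral_sub hvi (hψi.mul_const _)]
      refine integral_mono (hvi.sub (hψi.mul_const _)) (hi k) fun x => ?_
      have := mul_le_mul_of_nonneg_left (hb k x).2.2 (hψ0 x)
      simpa [mul_sub] using this

theorem contDiff_top_lap {f : Euc n → ℝ} (hf : ContDiff ℝ ∞ f) : ContDiff ℝ ∞ (lap f) :=
  ContDiff.sum fun i _ =>
    ((hf.fderiv_apply_const (k := ⊤) (m := ⊤) le_rfl _).fderiv_apply_const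
      (k := ⊤) (m := ⊤) le_rfl (stdVec i))

/-- A smooth function on `ℝ` that agrees with `s ^ a` for `1 ≤ s`. -/
noncomputable def smoothPow (a s : ℝ) : ℝ := Real.smoothTransition (2 * s - 1) * s ^ a

theorem smoothPow_of_one_le (a : ℝ) {s : ℝ} (hs : 1 ≤ s) : smoothPow a s = s ^ a := by
  rw [smoothPow, Real.smoothTransition.one_of_one_le (by linarith), one_mul]

theorem contDiff_smoothPow (a : ℝ) : ContDiff ℝ ∞ (smoothPow a) := by
  rw [contDiff_iff_contDiffAt]
  intro s
  rcases lt_or_ge s (1 / 2) with hs | hs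
  · have : smoothPow a =ᶠ[𝓝 s] fun _ => 0 := by
      filter_upwards [gt_mem_nhds hs] with t ht
      rw [smoothPow, Real.smoothTransition.zero_of_nonpos (by linarith), zero_mul]
    exact contDiffAt_const.congr_of_eventuallyEq this
  · unfold smoothPow
    refine ContDiffAt.mul (ContDiff.contDiffAt ?_)
      (Real.contDiffAt_rpow_const_of_ne (by linarith))
    exact Real.smoothTransition.contDiff.comp (by fun_prop)

theorem deriv_smoothPow (a : ℝ) {s : ℝ} (hs : 1 < s) :
    deriv (smoothPow a) s = a * s ^ (a - 1) := by
  have : smoothPow a =ᶠ[𝓝 s] fun t => t ^ a := by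
    filter_upwards [lt_mem_nhds hs] with t ht using smoothPow_of_one_le a ht.le
  rw [this.deriv_eq, Real.deriv_rpow_const]

theorem deriv_deriv_smoothPow (a : ℝ) {s : ℝ} (hs : 1 < s) :
    deriv (deriv (smoothPow a)) s = a * ((a - 1) * s ^ (a - 2)) := by
  have : deriv (smoothPow a) =ᶠ[𝓝 s] fun t => a * t ^ (a - 1) := by
    filter_upwards [lt_mem_nhds hs] with t ht using deriv_smoothPow a ht
  rw [this.deriv_eq, deriv_const_mul_field, Real.deriv_rpow_const]
  ring_nf

/-- The radial profile of the Laplacian of `smoothPow (1 - n / 2) (‖x‖ ^ 2)`. -/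
noncomputable def lapProfile (n : ℕ) (r : ℝ) : ℝ :=
  2 * n * deriv (smoothPow (1 - n / 2)) (r ^ 2)
    + 4 * r ^ 2 * deriv (deriv (smoothPow (1 - n / 2))) (r ^ 2)

theorem lapProfile_eq_zero {r : ℝ} (hr : 1 < r ^ 2) : lapProfile n r = 0 := by
  rw [lapProfile, deriv_smoothPow _ hr, deriv_deriv_smoothPow _ hr]
  have h : (r ^ 2) ^ ((1 - n / 2 : ℝ) - 1) = r ^ 2 * (r ^ 2) ^ ((1 - n / 2 : ℝ) - 2) := by
    rw [show ((1 - n / 2 : ℝ) - 1) = 1 + ((1 - n / 2 : ℝ) - 2) by ring,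
      Real.rpow_add (by linarith), Real.rpow_one]
  rw [h]
  ring

theorem continuous_lapProfile : Continuous (lapProfile n) := by
  have h := contDiff_smoothPow (1 - n / 2)
  have h1 : Continuous (deriv (smoothPow (1 - n / 2 : ℝ))) := h.continuous_deriv (by simp)
  have h2 : Continuous (deriv (deriv (smoothPow (1 - n / 2 : ℝ)))) :=
    (contDiff_infty_iff_deriv.1 h).2.continuous_deriv (by simp)
  unfold lapProfile
  fun_prop

theorem integral_lapProfile (hn : 0 < n) :
    ∫ r in Set.Ioi (0 : ℝ), r ^ (n - 1) * lapProfile n r = 2 - n := by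
  set a : ℝ := 1 - n / 2 with ha
  have hs := contDiff_smoothPow a
  have hc : Continuous fun r : ℝ => r ^ (n - 1) * lapProfile n r :=
    (continuous_pow _).mul continuous_lapProfile
  have hcs : HasCompactSupport fun r : ℝ => r ^ (n - 1) * lapProfile n r := by
    refine HasCompactSupport.intro (isCompact_Icc (a := (-1 : ℝ)) (b := 1)) fun r hr => ?_
    rw [lapProfile_eq_zero, mul_zero]
    by_contra! h
    exact hr (abs_le.1 (by simpa using h))
  have hd : ∀ r : ℝ, HasDerivAt (fun r : ℝ => 2 * r ^ n * deriv (smoothPow a) (r ^ 2))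
      (r ^ (n - 1) * lapProfile n r) r := by
    intro r
    have h1 : HasDerivAt (deriv (smoothPow a)) (deriv (deriv (smoothPow a)) (r ^ 2)) (r ^ 2) :=
      ((contDiff_infty_iff_deriv.1 hs).2.differentiable (by simp) _).hasDerivAt
    have h2 := HasDerivAt.comp (h := fun t : ℝ => t ^ 2) r h1 (hasDerivAt_pow 2 r)
    have h3 := ((hasDerivAt_pow n r).const_mul 2).mul h2
    refine HasDerivAt.congr_deriv (f := fun r : ℝ => 2 * r ^ n * deriv (smoothPow a) (r ^ 2)) h3 ?_
    obtain ⟨m, rfl⟩ := Nat.exists_eq_add_of_lt hn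
    simp only [lapProfile, ← ha]
    simp
    ring
  rw [integral_Ioi_of_hasDerivAt_of_tendsto' (m := (2 - n : ℝ)) (fun r _ => hd r)
    (hc.integrable_of_hasCompactSupport hcs).integrableOn]
  · simp [hn.ne']
  · refine tendsto_const_nhds.congr' ?_
    filter_upwards [eventually_gt_atTop (1 : ℝ)] with r hr
    have h0 : 0 < r := by linarith
    rw [deriv_smoothPow a (by nlinarith), ← Real.rpow_natCast r 2, ← Real.rpow_mul h0.le,
      ← Real.rpow_natCast r n]
    have : r ^ (n : ℝ) * r ^ (((2 : ℕ) : ℝ) * (a - 1)) = 1 := by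
      rw [← Real.rpow_add h0, ha]
      norm_num
      ring_nf
      exact Real.rpow_zero r
    linear_combination (-2 * a) * this + 2 * ha

theorem exists_kernel (hn : 3 ≤ n) : ∃ η ζ : Euc n → ℝ, ContDiff ℝ ∞ η ∧ ContDiff ℝ ∞ ζ ∧
    (∀ x, 1 < ‖x‖ → η x = 0) ∧ (∀ x, 1 < ‖x‖ → ζ x = 0) ∧ ∫ x, η x = 1 ∧
    ∀ x, lap ζ x = 2 ^ n * η ((2 : ℝ) • x) - η x := by
  set a : ℝ := 1 - n / 2 with ha
  have hs := contDiff_smoothPow a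
  set g : Euc n → ℝ := fun x => smoothPow a (‖x‖ ^ 2) with hg
  have hgc : ContDiff ℝ ∞ g := hs.comp (contDiff_norm_sq ℝ)
  have hg2 : ContDiff ℝ 2 g := hgc.of_le ENat.LEInfty.out
  have hlap : ∀ x, lap g x = lapProfile n ‖x‖ := fun x =>
    lap_radial (hs.of_le ENat.LEInfty.out) x
  have hfin : Module.finrank ℝ (Euc n) = n := by simp
  have : Nontrivial (Euc n) := Module.nontrivial_of_finrank_pos (R := ℝ) (by omega)
  have hI : ∫ x, lap g x ≠ 0 := by
    simp only [hlap]
    rw [integral_fun_norm_addHaar volume (lapProfile n), hfin]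
    simp only [smul_eq_mul, integral_lapProfile (by omega : 0 < n)]
    have h3 : (3 : ℝ) ≤ n := by exact_mod_cast hn
    have hv : 0 < volume.real (Metric.ball (0 : Euc n) 1) :=
      ENNReal.toReal_pos (Metric.measure_ball_pos volume _ one_pos).ne' measure_ball_lt_top.ne
    rw [nsmul_eq_mul]
    refine mul_ne_zero (by positivity) (mul_ne_zero hv.ne' (by linarith))
  set I := ∫ x, lap g x with hIdef
  have hsc : ∀ x, lap (fun y => g ((2 : ℝ) • y)) x = 4 * lap g ((2 : ℝ) • x) := fun x => by
    have := lap_comp_affine hg2 2 0 x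
    simp only [add_zero] at this
    rw [this]
    norm_num
  have hg2' : ContDiff ℝ ∞ fun y => g ((2 : ℝ) • y) := hgc.comp (by fun_prop)
  refine ⟨fun x => I⁻¹ * lap g x, fun x => I⁻¹ * (2 ^ (n - 2) * g ((2 : ℝ) • x) - g x),
    contDiff_const.mul (contDiff_top_lap hgc),
    contDiff_const.mul ((contDiff_const.mul hg2').sub hgc), fun x hx => ?_, fun x hx => ?_, ?_,
    fun x => ?_⟩
  · simp only
    rw [hlap, lapProfile_eq_zero (by nlinarith), mul_zero]
  · have h1 : (1 : ℝ) ≤ ‖x‖ ^ 2 := by nlinarith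
    simp only [hg]
    rw [norm_smul, mul_pow, smoothPow_of_one_le a h1, smoothPow_of_one_le a (by norm_num; linarith),
      Real.mul_rpow (by positivity) (by positivity)]
    have : (2 : ℝ) ^ (n - 2) * (‖(2 : ℝ)‖ ^ 2) ^ a = 1 := by
      rw [Real.norm_of_nonneg (by norm_num), ← Real.rpow_natCast, ← Real.rpow_natCast,
        ← Real.rpow_mul (by norm_num), ← Real.rpow_add (by norm_num), ha,
        Nat.cast_sub (by omega)]
      norm_num
      ring_nf
      exact Real.rpow_zero 2
    rw [← mul_assoc, this]
    ring
  · rw [integral_const_mul, inv_mul_cancel₀ hI]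
  · have c2 : ContDiff ℝ 2 fun y => g ((2 : ℝ) • y) := hg2'.of_le ENat.LEInfty.out
    rw [lap_const_mul ((contDiff_const.mul c2).sub hg2), lap_sub (contDiff_const.mul c2) hg2,
      lap_const_mul c2, hsc]
    obtain ⟨m, rfl⟩ := Nat.exists_eq_add_of_le' (show 2 ≤ n by omega)
    simp only [Nat.add_sub_cancel]
    ring

end

section

open Filter MeasureTheory
open scoped Topology ContDiff
variable {n : ℕ} {F : Type*} [NormedAddCommGroup F] [NormedSpace ℝ F]

/-- Mollification of `q` by the rescaled kernel `k (s • ·)`. -/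
noncomputable def moll (k : Euc n → F) (s : ℝ) (q : Euc n → ℝ) (x : Euc n) : F :=
  ∫ y, q y • k (s • (x - y))

theorem locallyIntegrable_of_abs_le {w b : Euc n → ℝ} (hb : Continuous b) (hw : Measurable w)
    (hwb : ∀ x, |w x| ≤ b x) : LocallyIntegrable w :=
  hb.locallyIntegrable.mono hw.aestronglyMeasurable
    (.of_forall fun x => (hwb x).trans (le_abs_self _))

theorem hasCompactSupport_of_one_lt_norm {G : Type*} [Zero G] {k : Euc n → G} (hk : ∀ z, 1 < ‖z‖ → k z = 0) :
    HasCompactSupport k :=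
  HasCompactSupport.intro (isCompact_closedBall (0 : Euc n) 1) fun z hz => hk z (by simpa using hz)

theorem hasCompactSupport_comp_affine {G : Type*} [Zero G] {k : Euc n → G} (hk : ∀ z, 1 < ‖z‖ → k z = 0) {s : ℝ}
    (hs : 0 < s) (x : Euc n) : HasCompactSupport fun y => k (s • (x - y)) := by
  refine HasCompactSupport.intro (isCompact_closedBall x (1 / s)) fun y hy => hk _ ?_
  rw [Metric.mem_closedBall, not_le, dist_comm, dist_eq_norm, div_lt_iff₀ hs] at hy
  rwa [norm_smul, Real.norm_of_nonneg hs.le, mul_comm]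

theorem fderiv_eq_zero_of_one_lt_norm {k : Euc n → F} (hk : ∀ z, 1 < ‖z‖ → k z = 0) {z : Euc n}
    (hz : 1 < ‖z‖) : fderiv ℝ k z = 0 := by
  have : k =ᶠ[𝓝 z] fun _ => 0 := by
    filter_upwards [(isOpen_lt continuous_const continuous_norm).mem_nhds hz] with y hy
    exact hk y hy
  rw [this.fderiv_eq]
  simp

theorem hasFDerivAt_moll {k : Euc n → F} (hk : ContDiff ℝ 1 k) (hk0 : ∀ z, 1 < ‖z‖ → k z = 0)
    {s : ℝ} (hs : 0 < s) {q : Euc n → ℝ} (hq : LocallyIntegrable q) (x : Euc n) :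
    HasFDerivAt (moll k s q) (s • moll (fderiv ℝ k) s q x) x := by
  have hc : ContDiff ℝ 1 fun t : Euc n => k (s • t) := hk.comp (by fun_prop)
  have hcs : HasCompactSupport fun t : Euc n => k (s • t) :=
    (hasCompactSupport_of_one_lt_norm hk0).comp_smul hs.ne'
  have h := hcs.hasFDerivAt_convolution_left (ContinuousLinearMap.lsmul ℝ ℝ : ℝ →L[ℝ] F →L[ℝ] F).flip
    hc hq x (μ := volume)
  have e1 : convolution (fun t : Euc n => k (s • t)) q
      (ContinuousLinearMap.lsmul ℝ ℝ : ℝ →L[ℝ] F →L[ℝ] F).flip volume = moll k s q := by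
    ext x
    rw [MeasureTheory.convolution_eq_swap]
    rfl
  have hd : ∀ t, fderiv ℝ (fun t : Euc n => k (s • t)) t = s • fderiv ℝ k (s • t) := fun t => by
    rw [fderiv_comp_smul]
  rw [e1, MeasureTheory.convolution_eq_swap] at h
  refine h.congr_fderiv ?_
  rw [moll, ← integral_smul]
  congr 1
  ext y v
  simp [ContinuousLinearMap.precompL, hd, smul_smul]

theorem norm_integral_le_of_closedBall {f : Euc n → F} {x : Euc n} {s B : ℝ} (hs : 0 < s)
    (hf : ∀ y, ‖x - y‖ ≤ 1 / s → ‖f y‖ ≤ B) (hf0 : ∀ y, 1 / s < ‖x - y‖ → f y = 0) :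
    ‖s ^ n • ∫ y, f y‖ ≤ B * volume.real (Metric.closedBall (0 : Euc n) 1) := by
  rw [← setIntegral_eq_integral_of_forall_compl_eq_zero (s := Metric.closedBall x (1 / s))
    fun y hy => hf0 y (by simpa [dist_comm y, dist_eq_norm] using hy)]
  have h := norm_setIntegral_le_of_norm_le_const (μ := volume) (f := f)
    (s := Metric.closedBall x (1 / s)) (C := B)
    measure_closedBall_lt_top fun y hy => hf y (by simpa [dist_comm y, dist_eq_norm] using hy)
  rw [Measure.addHaar_real_closedBall' _ _ (by positivity)] at h
  rw [norm_smul, Real.norm_of_nonneg (by positivity)]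
  calc s ^ n * _ ≤ s ^ n * (B * ((1 / s) ^ Module.finrank ℝ (Euc n) * volume.real (Metric.closedBall (0 : Euc n) 1))) := by gcongr
    _ = _ := by
      have : Module.finrank ℝ (Euc n) = n := by simp
      rw [this, div_pow, one_pow]
      field_simp

theorem norm_moll_le {k : Euc n → F} (hk0 : ∀ z, 1 < ‖z‖ → k z = 0) {C B : ℝ}
    (hk : ∀ z, ‖k z‖ ≤ C) {s : ℝ} (hs : 0 < s) {q : Euc n → ℝ} {x : Euc n}
    (hq : ∀ y, ‖x - y‖ ≤ 1 / s → |q y| ≤ B) :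
    ‖s ^ n • moll k s q x‖ ≤ B * C * volume.real (Metric.closedBall (0 : Euc n) 1) := by
  refine norm_integral_le_of_closedBall (x := x) hs (fun y hy => ?_) fun y hy => ?_
  · rw [norm_smul]
    exact mul_le_mul (hq y hy) (hk _) (norm_nonneg _) ((abs_nonneg _).trans (hq y hy))
  · rw [hk0, smul_zero]
    rw [div_lt_iff₀ hs] at hy
    rwa [norm_smul, Real.norm_of_nonneg hs.le, mul_comm]

theorem moll_sub_moll {η ζ : Euc n → ℝ} (hη : Continuous η) (hη0 : ∀ z, 1 < ‖z‖ → η z = 0)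
    (hζ : ContDiff ℝ 2 ζ) (hζ0 : ∀ z, 1 < ‖z‖ → ζ z = 0)
    (hζη : ∀ x, lap ζ x = 2 ^ n * η ((2 : ℝ) • x) - η x) {w q b : Euc n → ℝ} (hb : Continuous b)
    (hw : Measurable w) (hwb : ∀ x, |w x| ≤ b x)
    (hwq : ∀ ψ : Euc n → ℝ, ContDiff ℝ 2 ψ → HasCompactSupport ψ →
      ∫ x, lap ψ x * w x = ∫ x, ψ x * q x) {s : ℝ} (hs : 0 < s) (x : Euc n) :
    (2 * s) ^ n • moll η (2 * s) w x - s ^ n • moll η s w x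
      = s⁻¹ ^ 2 • (s ^ n • moll ζ s q x) := by
  have hψ : ContDiff ℝ 2 fun y => ζ (s • (x - y)) := hζ.comp (by fun_prop)
  have hl : ∀ y, lap (fun y => ζ (s • (x - y))) y = s ^ 2 * lap ζ (s • (x - y)) := fun y => by
    have := lap_comp_affine hζ (-s) (s • x) y
    have e : ∀ y : Euc n, -s • y + s • x = s • (x - y) := fun y => by
      rw [smul_sub]; module
    simp only [e] at this
    rw [this]
    ring
  have h := hwq _ hψ (hasCompactSupport_comp_affine hζ0 hs x)
  have i1 : ∀ t : ℝ, 0 < t → Integrable fun y => η (t • (x - y)) * w y := fun t ht =>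
    integrable_mul_of_abs_le (ψ := fun y => η (t • (x - y))) (by fun_prop)
      (hasCompactSupport_comp_affine hη0 ht x) hb hw hwb
  have e2 : ∫ y, ζ (s • (x - y)) * q y = moll ζ s q x := by
    simp only [moll, smul_eq_mul, mul_comm]
  have e3 : ∀ t, moll η t w x = ∫ y, η (t • (x - y)) * w y := fun t => by
    simp only [moll, smul_eq_mul, mul_comm]
  rw [← e2, ← h, e3, e3]
  simp only [hl, hζη, smul_smul, smul_eq_mul]
  rw [← integral_const_mul, ← integral_const_mul, ← integral_sub ((i1 _ (by positivity)).const_mul _)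
    ((i1 _ hs).const_mul _), ← integral_const_mul,
    ← integral_const_mul]
  congr 1
  ext y
  field_simp
  ring

theorem exists_tendstoLocallyUniformly_of_geometric {G : Type*} [NormedAddCommGroup G]
    [CompleteSpace G] {f : ℕ → Euc n → G}
    (hf : ∀ ρ : ℝ, ∃ C : ℝ, ∀ j x, ‖x‖ < ρ → ‖f (j + 1) x - f j x‖ ≤ C * (1 / 2) ^ j) :
    ∃ L : Euc n → G, TendstoLocallyUniformly f L atTop := by
  refine ⟨fun x => f 0 x + ∑' j, (f (j + 1) x - f j x), ?_⟩
  rw [← tendstoLocallyUniformlyOn_univ]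
  refine tendstoLocallyUniformlyOn_of_forall_exists_nhds fun x _ => ?_
  obtain ⟨C, hC⟩ := hf (‖x‖ + 1)
  refine ⟨Metric.ball 0 (‖x‖ + 1), ?_, ?_⟩
  · exact mem_nhdsWithin_of_mem_nhds (Metric.isOpen_ball.mem_nhds (by simp))
  · have h := tendstoUniformlyOn_tsum_nat (f := fun j x => f (j + 1) x - f j x)
      ((summable_geometric_of_lt_one (by norm_num) (by norm_num : (1 / 2 : ℝ) < 1)).mul_left C)
      (s := Metric.ball (0 : Euc n) (‖x‖ + 1)) fun j y hy => hC j y (by simpa using hy)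
    rw [Metric.tendstoUniformlyOn_iff] at h ⊢
    intro ε hε
    filter_upwards [h ε hε] with N hN y hy
    have := hN y hy
    rw [Finset.sum_range_sub (fun j => f j y)] at this
    rw [dist_eq_norm] at this ⊢
    convert this using 2
    abel

theorem hasFDerivAt_of_tendstoLocallyUniformly {f : ℕ → Euc n → F} {g : Euc n → F}
    {f' : ℕ → Euc n → Euc n →L[ℝ] F} {g' : Euc n → Euc n →L[ℝ] F}
    (hf' : TendstoLocallyUniformly f' g' atTop) (hf : ∀ N x, HasFDerivAt (f N) (f' N x) x)
    (hfg : ∀ x, Tendsto (fun N => f N x) atTop (𝓝 (g x))) (x : Euc n) :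
    HasFDerivAt g (g' x) x :=
  hasFDerivAt_of_tendstoLocallyUniformlyOn isOpen_univ
    (tendstoLocallyUniformlyOn_univ.2 hf') (fun N x _ => hf N x) (fun x _ => hfg x) (Set.mem_univ x)

theorem TendstoLocallyUniformly.tendsto_apply {G : Type*} [NormedAddCommGroup G] {f : ℕ → Euc n → G}
    {g : Euc n → G} (h : TendstoLocallyUniformly f g atTop) (x : Euc n) :
    Tendsto (fun N => f N x) atTop (𝓝 (g x)) :=
  (tendstoLocallyUniformlyOn_univ.2 h).tendsto_at (Set.mem_univ x)

/-- The average of `V` near `x` at scale `t`, weighted by `η`. -/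
noncomputable def avg (η : Euc n → ℝ) (t : ℝ) (V : Euc n → F) (x : Euc n) : F :=
  ∫ z, η z • V (x - t • z)

theorem moll_eq_avg (η : Euc n → ℝ) {s : ℝ} (hs : 0 < s) (V : Euc n → ℝ) (x : Euc n) :
    s ^ n • moll η s V x = avg η s⁻¹ V x := by
  have h1 : moll η s V x = ∫ y, V (x - y) • η (s • y) := by
    rw [moll, ← integral_sub_left_eq_self _ volume x]
    simp
  have h2 := Measure.integral_comp_smul (volume : Measure (Euc n))
    (fun z => V (x - s⁻¹ • z) • η z) s
  simp only [inv_smul_smul₀ hs.ne', finrank_euclideanSpace, Fintype.card_fin] at h2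
  rw [h1, h2, abs_of_pos (by positivity), smul_smul, mul_inv_cancel₀ (by positivity), one_smul, avg]
  simp only [smul_eq_mul, mul_comm]

theorem tendstoLocallyUniformly_avg [CompleteSpace F] {η : Euc n → ℝ} (hη : Continuous η)
    (hη0 : ∀ z, 1 < ‖z‖ → η z = 0) (hη1 : ∫ z, η z = 1) {V : Euc n → F} (hV : Continuous V)
    {t : ℕ → ℝ} (ht : Tendsto t atTop (𝓝 0)) :
    TendstoLocallyUniformly (fun N => avg η (t N) V) V atTop := by
  have hcs : HasCompactSupport η := hasCompactSupport_of_one_lt_norm hη0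
  have hηi : Integrable η := hη.integrable_of_hasCompactSupport hcs
  rw [← tendstoLocallyUniformlyOn_univ]
  refine tendstoLocallyUniformlyOn_of_forall_exists_nhds fun x _ => ?_
  refine ⟨Metric.ball x 1, mem_nhdsWithin_of_mem_nhds (Metric.ball_mem_nhds x one_pos), ?_⟩
  rw [Metric.tendstoUniformlyOn_iff]
  intro ε hε
  have hI : 0 ≤ ∫ z, |η z| := integral_nonneg fun z => abs_nonneg _
  obtain ⟨δ, hδ, hδV⟩ := Metric.uniformContinuousOn_iff.1
    ((isCompact_closedBall x 2).uniformContinuousOn_of_continuous hV.continuousOn)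
    (ε / (2 * ((∫ z, |η z|) + 1))) (by positivity)
  filter_upwards [Metric.tendsto_nhds.1 ht (min δ 1) (by positivity)] with N hN y hy
  rw [Real.dist_eq, sub_zero, lt_min_iff] at hN
  have e : V y - avg η (t N) V y = ∫ z, η z • (V y - V (y - t N • z)) := by
    simp only [smul_sub]
    rw [integral_sub, integral_smul_const, hη1, one_smul, avg]
    · exact hηi.smul_const _
    · exact (by fun_prop : Continuous fun z => η z • V (y - t N • z)).integrable_of_hasCompactSupport
        hcs.smul_right
  rw [dist_eq_norm, e]
  have hb : ∀ z, ‖η z • (V y - V (y - t N • z))‖ ≤ |η z| * (ε / (2 * ((∫ z, |η z|) + 1))) := by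
    intro z
    rw [norm_smul, Real.norm_eq_abs]
    by_cases hz : 1 < ‖z‖
    · simp [hη0 z hz]
    · have hz' : ‖t N • z‖ ≤ |t N| := by
        rw [norm_smul, Real.norm_eq_abs]
        exact mul_le_of_le_one_right (abs_nonneg _) (not_lt.1 hz)
      rw [Metric.mem_ball] at hy
      refine mul_le_mul_of_nonneg_left ?_ (abs_nonneg _)
      rw [← dist_eq_norm]
      refine (hδV y ?_ _ ?_ ?_).le
      · rw [Metric.mem_closedBall]; linarith
      · rw [Metric.mem_closedBall]
        have : dist (y - t N • z) y ≤ 1 := by rw [dist_eq_norm]; simp; linarith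
        linarith [dist_triangle (y - t N • z) y x]
      · rw [dist_eq_norm]; simp; linarith
  refine (norm_integral_le_of_norm_le (hηi.abs.mul_const _) (.of_forall hb)).trans_lt ?_
  rw [integral_mul_const, mul_div_assoc', div_lt_iff₀ (by positivity)]
  nlinarith

theorem hasFDerivAt_avg {η : Euc n → ℝ} (hη : Continuous η) (hη0 : ∀ z, 1 < ‖z‖ → η z = 0)
    {V : Euc n → F} (hV : ContDiff ℝ 1 V) (t : ℝ) (x : Euc n) :
    HasFDerivAt (avg η t V) (avg η t (fderiv ℝ V) x) x := by
  have hcs : HasCompactSupport η := hasCompactSupport_of_one_lt_norm hη0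
  have hηi : Integrable η := hη.integrable_of_hasCompactSupport hcs
  have hVc := hV.continuous
  have hV' := hV.continuous_fderiv one_ne_zero
  obtain ⟨C, hC⟩ := (isCompact_closedBall x (1 + |t|)).exists_bound_of_continuousOn hV'.continuousOn
  refine hasFDerivAt_integral_of_dominated_of_fderiv_le (s := Metric.ball x 1)
    (F := fun x z => η z • V (x - t • z)) (F' := fun x z => η z • fderiv ℝ V (x - t • z))
    (bound := fun z => |η z| * C) (Metric.ball_mem_nhds x one_pos) ?_ ?_ ?_ ?_ ?_ ?_
  · exact .of_forall fun y => (by fun_prop : Continuous fun z => η z • V (y - t • z)).aestronglyMeasurable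
  · exact (by fun_prop : Continuous fun z => η z • V (x - t • z)).integrable_of_hasCompactSupport
        hcs.smul_right
  · exact (by fun_prop : Continuous fun z => η z • fderiv ℝ V (x - t • z)).aestronglyMeasurable
  · refine .of_forall fun z y hy => ?_
    rw [norm_smul, Real.norm_eq_abs]
    by_cases hz : 1 < ‖z‖
    · simp [hη0 z hz]
    · refine mul_le_mul_of_nonneg_left (hC _ ?_) (abs_nonneg _)
      have hz' : ‖t • z‖ ≤ |t| := by
        rw [norm_smul, Real.norm_eq_abs]
        exact mul_le_of_le_one_right (abs_nonneg _) (not_lt.1 hz)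
      rw [Metric.mem_ball] at hy
      rw [Metric.mem_closedBall]
      have : dist (y - t • z) y ≤ |t| := by rw [dist_eq_norm]; simpa using hz'
      linarith [dist_triangle (y - t • z) y x]
  · exact hηi.abs.mul_const _
  · refine .of_forall fun z y _ => ?_
    have h := ((hV.differentiable one_ne_zero) (y - t • z)).hasFDerivAt.comp y
      ((hasFDerivAt_id y).sub_const (t • z))
    exact (h.const_smul (η z)).congr_fderiv (by ext; simp)

theorem integral_lap_mul {v ψ : Euc n → ℝ} (hv : ContDiff ℝ 2 v) (hψ : ContDiff ℝ 2 ψ)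
    (hs : HasCompactSupport ψ) : ∫ x, lap ψ x * v x = ∫ x, ψ x * lap v x := by
  have hd : ∀ {f : Euc n → ℝ} (_ : ContDiff ℝ 2 f) (i : Fin n),
      ContDiff ℝ 1 fun y => fderiv ℝ f y (stdVec i) := fun hf i => contDiff_one_fderiv_apply hf _
  have hc : ∀ {f : Euc n → ℝ} (_ : ContDiff ℝ 2 f) (i : Fin n),
      Continuous fun y => fderiv ℝ (fun y => fderiv ℝ f y (stdVec i)) y (stdVec i) := fun hf i =>
    ((hd hf i).continuous_fderiv one_ne_zero).clm_apply continuous_const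
  have hs1 : ∀ i, HasCompactSupport fun y => fderiv ℝ ψ y (stdVec i) := fun i =>
    hs.fderiv_apply (𝕜 := ℝ) _
  have hs2 : ∀ i, HasCompactSupport
      fun y => fderiv ℝ (fun y => fderiv ℝ ψ y (stdVec i)) y (stdVec i) := fun i =>
    (hs1 i).fderiv_apply (𝕜 := ℝ) _
  have hvd := hv.differentiable two_ne_zero
  have hψd := hψ.differentiable two_ne_zero
  simp only [lap, Finset.sum_mul, Finset.mul_sum]
  rw [integral_finsetSum, integral_finsetSum]
  · refine Finset.sum_congr rfl fun i _ => ?_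
    have h1 := integral_mul_fderiv_eq_neg_fderiv_mul_of_integrable (μ := (volume : Measure (Euc n)))
      (f := v) (g := fun y => fderiv ℝ ψ y (stdVec i)) (v := stdVec i) ?_ ?_ ?_ (fun x _ => hvd x)
      fun x _ => (hd hψ i).differentiable one_ne_zero x
    have h2 := integral_mul_fderiv_eq_neg_fderiv_mul_of_integrable (μ := (volume : Measure (Euc n)))
      (f := ψ) (g := fun y => fderiv ℝ v y (stdVec i)) (v := stdVec i) ?_ ?_ ?_ (fun x _ => hψd x)
      fun x _ => (hd hv i).differentiable one_ne_zero x
    · have e : ∫ x, fderiv ℝ v x (stdVec i) * fderiv ℝ ψ x (stdVec i)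
          = ∫ x, fderiv ℝ ψ x (stdVec i) * fderiv ℝ v x (stdVec i) := by simp only [mul_comm]
      rw [e, ← h2] at h1
      rw [← h1]
      simp only [mul_comm]
    · exact ((hd hψ i).continuous.mul (hd hv i).continuous).integrable_of_hasCompactSupport
        (hs1 i).mul_right
    · exact (hψ.continuous.mul (hc hv i)).integrable_of_hasCompactSupport hs.mul_right
    · exact (hψ.continuous.mul (hd hv i).continuous).integrable_of_hasCompactSupport hs.mul_right
    · exact ((hd hv i).continuous.mul (hd hψ i).continuous).integrable_of_hasCompactSupport
        (hs1 i).mul_left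
    · exact (hv.continuous.mul (hc hψ i)).integrable_of_hasCompactSupport (hs2 i).mul_left
    · exact (hv.continuous.mul (hd hψ i).continuous).integrable_of_hasCompactSupport
        (hs1 i).mul_left
  · exact fun i _ => (hψ.continuous.mul (hc hv i)).integrable_of_hasCompactSupport hs.mul_right
  · exact fun i _ => ((hc hψ i).mul hv.continuous).integrable_of_hasCompactSupport (hs2 i).mul_right

theorem exists_norm_moll_le {k : Euc n → F} (hk : Continuous k) (hk0 : ∀ z, 1 < ‖z‖ → k z = 0)
    {q b : Euc n → ℝ} (hb : Continuous b) (hq : ∀ x, |q x| ≤ b x) (ρ : ℝ) :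
    ∃ C, ∀ s x, 1 ≤ s → ‖x‖ < ρ → ‖s ^ n • moll k s q x‖ ≤ C := by
  obtain ⟨C, hC⟩ := (hasCompactSupport_of_one_lt_norm hk0).exists_bound_of_continuous hk
  obtain ⟨B, hB⟩ := (isCompact_closedBall (0 : Euc n) (ρ + 1)).exists_bound_of_continuousOn
    hb.continuousOn
  refine ⟨_, fun s x hs hx => norm_moll_le hk0 hC (B := B) (one_pos.trans_le hs) fun y hy => ?_⟩
  refine (hq y).trans ((le_abs_self _).trans (hB y ?_))
  have h1 : 1 / s ≤ 1 := by rw [div_le_one (by positivity)]; exact hs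
  rw [mem_closedBall_zero_iff]
  have := norm_sub_le x (x - y)
  rw [sub_sub_cancel] at this
  linarith

section Dyadic

variable {η ζ : Euc n → ℝ} (hη : ContDiff ℝ ∞ η) (hη0 : ∀ z, 1 < ‖z‖ → η z = 0)
  (hζ : ContDiff ℝ ∞ ζ) (hζ0 : ∀ z, 1 < ‖z‖ → ζ z = 0)
  (hζη : ∀ x, lap ζ x = 2 ^ n * η ((2 : ℝ) • x) - η x) {w q b : Euc n → ℝ} (hb : Continuous b)
  (hw : Measurable w) (hwb : ∀ x, |w x| ≤ b x) (hq : LocallyIntegrable q)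
  (hwq : ∀ ψ : Euc n → ℝ, ContDiff ℝ 2 ψ → HasCompactSupport ψ →
      ∫ x, lap ψ x * w x = ∫ x, ψ x * q x)

include hη hη0 hζ hζ0 hζη hb hw hwb hwq

include hq in
theorem moll_fderiv_sub_moll_fderiv {s : ℝ} (hs : 0 < s) (x : Euc n) :
    (2 * s) ^ n • (2 * s) • moll (fderiv ℝ η) (2 * s) w x - s ^ n • s • moll (fderiv ℝ η) s w x
      = s⁻¹ • s ^ n • moll (fderiv ℝ ζ) s q x := by
  have hwi := locallyIntegrable_of_abs_le hb hw hwb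
  have hη1 : ContDiff ℝ 1 η := hη.of_le (by exact_mod_cast le_top)
  have hζ1 : ContDiff ℝ 1 ζ := hζ.of_le (by exact_mod_cast le_top)
  have h1 := ((hasFDerivAt_moll hη1 hη0 (by positivity : 0 < 2 * s) hwi x).const_smul
    ((2 * s) ^ n)).sub ((hasFDerivAt_moll hη1 hη0 hs hwi x).const_smul (s ^ n))
  have h2 := ((hasFDerivAt_moll hζ1 hζ0 hs hq x).const_smul (s ^ n)).const_smul (s⁻¹ ^ 2)
  have e : ((2 * s) ^ n • moll η (2 * s) w) - (s ^ n • moll η s w)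
      = s⁻¹ ^ 2 • (s ^ n • moll ζ s q) := funext fun x =>
    moll_sub_moll hη.continuous hη0 (hζ.of_le ENat.LEInfty.out) hζ0 hζη hb hw hwb hwq hs x
  rw [e] at h1
  rw [h1.unique h2]
  simp only [smul_smul]
  congr 1
  field_simp

include hq in
theorem moll_fderiv_fderiv_sub_moll_fderiv_fderiv {s : ℝ} (hs : 0 < s) (x : Euc n) :
    (2 * s) ^ n • (2 * s) • (2 * s) • moll (fderiv ℝ (fderiv ℝ η)) (2 * s) w x
        - s ^ n • s • s • moll (fderiv ℝ (fderiv ℝ η)) s w x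
      = s ^ n • moll (fderiv ℝ (fderiv ℝ ζ)) s q x := by
  have hwi := locallyIntegrable_of_abs_le hb hw hwb
  have hη1 : ContDiff ℝ 1 (fderiv ℝ η) :=
      (contDiff_infty_iff_fderiv.1 hη).2.of_le (by exact_mod_cast le_top)
  have hζ1 : ContDiff ℝ 1 (fderiv ℝ ζ) :=
      (contDiff_infty_iff_fderiv.1 hζ).2.of_le (by exact_mod_cast le_top)
  have hη0' : ∀ z, 1 < ‖z‖ → fderiv ℝ η z = 0 := fun z => fderiv_eq_zero_of_one_lt_norm hη0
  have hζ0' : ∀ z, 1 < ‖z‖ → fderiv ℝ ζ z = 0 := fun z => fderiv_eq_zero_of_one_lt_norm hζ0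
  have h1 := (((hasFDerivAt_moll hη1 hη0' (by positivity : 0 < 2 * s) hwi x).const_smul
    (2 * s)).const_smul ((2 * s) ^ n)).sub
      (((hasFDerivAt_moll hη1 hη0' hs hwi x).const_smul s).const_smul (s ^ n))
  have h2 := ((hasFDerivAt_moll hζ1 hζ0' hs hq x).const_smul (s ^ n)).const_smul s⁻¹
  have e : ((2 * s) ^ n • (2 * s) • moll (fderiv ℝ η) (2 * s) w)
        - (s ^ n • s • moll (fderiv ℝ η) s w)
      = s⁻¹ • (s ^ n • moll (fderiv ℝ ζ) s q) := funext fun x =>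
    moll_fderiv_sub_moll_fderiv hη hη0 hζ hζ0 hζη hb hw hwb hq hwq hs x
  rw [e] at h1
  rw [h1.unique h2]
  simp only [smul_smul]
  congr 1
  field_simp

theorem exists_tendstoLocallyUniformly_moll {bq : Euc n → ℝ} (hbq : Continuous bq)
    (hqb : ∀ x, |q x| ≤ bq x) :
    ∃ W, TendstoLocallyUniformly (fun N : ℕ => ((2 : ℝ) ^ N) ^ n • moll η (2 ^ N) w) W atTop := by
  refine exists_tendstoLocallyUniformly_of_geometric fun ρ => ?_
  obtain ⟨C, hC⟩ := exists_norm_moll_le hζ.continuous hζ0 hbq hqb ρ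
  refine ⟨C, fun j x hx => ?_⟩
  have h := moll_sub_moll hη.continuous hη0 (hζ.of_le ENat.LEInfty.out) hζ0 hζη hb hw hwb hwq
    (s := 2 ^ j) (by positivity) x
  rw [← pow_succ'] at h
  simp only [Pi.smul_apply]
  rw [h, norm_smul, mul_comm]
  have h1 : ((1 : ℝ) / 2) ^ j ≤ 1 := pow_le_one₀ (by norm_num) (by norm_num)
  have h0 : (0 : ℝ) ≤ (1 / 2) ^ j := by positivity
  have h2 : ‖((2 : ℝ) ^ j)⁻¹ ^ 2‖ ≤ (1 / 2) ^ j := by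
    rw [Real.norm_of_nonneg (by positivity), ← inv_pow, ← one_div]
    nlinarith
  have h3 := hC (2 ^ j) x (one_le_pow₀ (by norm_num)) hx
  exact mul_le_mul h3 h2 (norm_nonneg _) ((norm_nonneg _).trans h3)

include hq in
theorem exists_tendstoLocallyUniformly_moll_fderiv {bq : Euc n → ℝ} (hbq : Continuous bq)
    (hqb : ∀ x, |q x| ≤ bq x) :
    ∃ W, TendstoLocallyUniformly
      (fun N : ℕ => ((2 : ℝ) ^ N) ^ n • (2 : ℝ) ^ N • moll (fderiv ℝ η) (2 ^ N) w) W atTop := by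
  refine exists_tendstoLocallyUniformly_of_geometric fun ρ => ?_
  obtain ⟨C, hC⟩ := exists_norm_moll_le (hζ.continuous_fderiv (by simp))
    (fun z => fderiv_eq_zero_of_one_lt_norm hζ0) hbq hqb ρ
  refine ⟨C, fun j x hx => ?_⟩
  have h := moll_fderiv_sub_moll_fderiv hη hη0 hζ hζ0 hζη hb hw hwb hq hwq
    (s := 2 ^ j) (by positivity) x
  rw [← pow_succ'] at h
  simp only [Pi.smul_apply]
  rw [h, norm_smul, mul_comm]
  have h2 : ‖((2 : ℝ) ^ j)⁻¹‖ ≤ (1 / 2) ^ j := by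
    rw [Real.norm_of_nonneg (by positivity), ← inv_pow, ← one_div]
  have h3 := hC (2 ^ j) x (one_le_pow₀ (by norm_num)) hx
  exact mul_le_mul h3 h2 (norm_nonneg _) ((norm_nonneg _).trans h3)

end Dyadic

theorem moll_one {η : Euc n → ℝ} (hη1 : ∫ z, η z = 1) {s : ℝ} (hs : 0 < s) (x : Euc n) :
    s ^ n • ∫ y, η (s • (x - y)) = 1 := by
  have := moll_eq_avg η hs (fun _ => 1) x
  simpa [moll, avg, hη1] using this

theorem ae_tendsto_moll {η : Euc n → ℝ} (hη : Continuous η) (hη0 : ∀ z, 1 < ‖z‖ → η z = 0)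
    (hη1 : ∫ z, η z = 1) {w b : Euc n → ℝ} (hb : Continuous b) (hw : Measurable w)
    (hwb : ∀ x, |w x| ≤ b x) :
    ∀ᵐ x, Tendsto (fun N : ℕ => ((2 : ℝ) ^ N) ^ n • moll η (2 ^ N) w x) atTop (𝓝 (w x)) := by
  have hwi := locallyIntegrable_of_abs_le hb hw hwb
  obtain ⟨C, hC⟩ := (hasCompactSupport_of_one_lt_norm hη0).exists_bound_of_continuous hη
  filter_upwards [IsUnifLocDoublingMeasure.ae_tendsto_average_norm_sub volume hwi 1] with x hx
  have hδ : Tendsto (fun N : ℕ => 1 / (2 : ℝ) ^ N) atTop (𝓝[>] 0) := by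
    refine tendsto_nhdsWithin_iff.2 ⟨?_, .of_forall fun N => Set.mem_Ioi.2 (by positivity)⟩
    simp only [← one_div_pow]
    exact tendsto_pow_atTop_nhds_zero_of_lt_one (by norm_num) (by norm_num)
  have h := hx (fun _ => x) (fun N : ℕ => 1 / (2 : ℝ) ^ N) hδ
    (.of_forall fun N => Metric.mem_closedBall_self (by positivity))
  have h' := h.const_mul (C * volume.real (Metric.closedBall (0 : Euc n) 1))
  rw [mul_zero] at h'
  rw [tendsto_iff_norm_sub_tendsto_zero]
  refine squeeze_zero (fun _ => norm_nonneg _) (fun N => ?_) h'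
  have hs : (0 : ℝ) < 2 ^ N := by positivity
  generalize (2 : ℝ) ^ N = s at hs ⊢
  have i1 : Integrable fun y => w y • η (s • (x - y)) := by
    simpa only [smul_eq_mul, mul_comm] using
      integrable_mul_of_abs_le (ψ := fun y => η (s • (x - y))) (by fun_prop)
      (hasCompactSupport_comp_affine hη0 hs x) hb hw hwb
  have i2 : Integrable fun y => η (s • (x - y)) :=
    (by fun_prop : Continuous fun y => η (s • (x - y))).integrable_of_hasCompactSupport
      (hasCompactSupport_comp_affine hη0 hs x)
  have e : s ^ n • moll η s w x - w x = s ^ n • ∫ y, (w y - w x) • η (s • (x - y)) := by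
    simp only [sub_smul]
    rw [integral_sub i1 (by exact i2.const_mul (w x)), integral_smul, smul_sub, smul_comm _ (w x),
      moll_one hη1 hs, moll]
    simp
  have hz : ∀ y ∉ Metric.closedBall x (1 / s), (w y - w x) • η (s • (x - y)) = 0 := fun y hy => by
    rw [hη0, smul_zero]
    rw [Metric.mem_closedBall, not_le, dist_comm, dist_eq_norm, div_lt_iff₀ hs] at hy
    rwa [norm_smul, Real.norm_of_nonneg hs.le, mul_comm]
  have hwo : IntegrableOn (fun y => ‖w y - w x‖) (Metric.closedBall x (1 / s)) := by
    refine Integrable.norm (Integrable.sub ?_ ?_)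
    · exact hwi.integrableOn_isCompact (isCompact_closedBall _ _)
    · exact integrableOn_const measure_closedBall_lt_top.ne
  rw [e, ← setIntegral_eq_integral_of_forall_compl_eq_zero hz, norm_smul, setAverage_eq]
  have hvol : volume.real (Metric.closedBall x (1 / s))
      = (1 / s) ^ n * volume.real (Metric.closedBall (0 : Euc n) 1) := by
    rw [Measure.addHaar_real_closedBall' _ _ (by positivity), finrank_euclideanSpace,
      Fintype.card_fin]
  have hV : 0 < volume.real (Metric.closedBall (0 : Euc n) 1) :=
    ENNReal.toReal_pos (Metric.measure_closedBall_pos _ _ one_pos).ne'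
      measure_closedBall_lt_top.ne
  have hle : ‖∫ y in Metric.closedBall x (1 / s), (w y - w x) • η (s • (x - y))‖
      ≤ (∫ y in Metric.closedBall x (1 / s), ‖w y - w x‖) * C := by
    rw [← integral_mul_const]
    refine norm_integral_le_of_norm_le (hwo.mul_const _) (.of_forall fun y => ?_)
    rw [norm_smul]
    exact mul_le_mul_of_nonneg_left (hC _) (norm_nonneg _)
  refine (mul_le_mul_of_nonneg_left hle (norm_nonneg _)).trans_eq ?_
  have hss : s ^ n * (1 / s) ^ n = 1 := by
    rw [← mul_pow, mul_one_div_cancel hs.ne', one_pow]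
  rw [hvol, Real.norm_of_nonneg (by positivity), smul_eq_mul]
  field_simp
  linear_combination C * (∫ y in Metric.closedBall x (1 / s), ‖w y - w x‖) * hss

/-- A locally bounded weak solution of `Δw = q` with `q` locally bounded is almost everywhere
equal to a `C¹` function. -/
theorem exists_contDiff_one_ae_eq (hn : 3 ≤ n) {w q b bq : Euc n → ℝ} (hb : Continuous b)
    (hw : Measurable w) (hwb : ∀ x, |w x| ≤ b x) (hq : Measurable q) (hbq : Continuous bq)
    (hqb : ∀ x, |q x| ≤ bq x)
    (hwq : ∀ ψ : Euc n → ℝ, ContDiff ℝ 2 ψ → HasCompactSupport ψ →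
      ∫ x, lap ψ x * w x = ∫ x, ψ x * q x) :
    ∃ W : Euc n → ℝ, ContDiff ℝ 1 W ∧ w =ᵐ[volume] W := by
  obtain ⟨η, ζ, hη, hζ, hη0, hζ0, hη1, hζη⟩ := exists_kernel hn
  have hwi := locallyIntegrable_of_abs_le hb hw hwb
  have hqi := locallyIntegrable_of_abs_le hbq hq hqb
  obtain ⟨W, hW⟩ := exists_tendstoLocallyUniformly_moll hη hη0 hζ hζ0 hζη hb hw hwb hwq hbq hqb
  obtain ⟨W', hW'⟩ :=
    exists_tendstoLocallyUniformly_moll_fderiv hη hη0 hζ hζ0 hζη hb hw hwb hqi hwq hbq hqb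
  refine ⟨W, contDiff_one_iff_hasFDerivAt.2 ⟨W', ?_, ?_⟩, ?_⟩
  · refine hW'.continuous (Frequently.of_forall fun N => ?_)
    have hη1 : ContDiff ℝ 1 (fderiv ℝ η) :=
      (contDiff_infty_iff_fderiv.1 hη).2.of_le (by exact_mod_cast le_top)
    have : Continuous (moll (fderiv ℝ η) (2 ^ N) w) := continuous_iff_continuousAt.2 fun x =>
      (hasFDerivAt_moll hη1 (fun z => fderiv_eq_zero_of_one_lt_norm hη0) (by positivity) hwi
        x).continuousAt
    exact (this.const_smul _).const_smul _
  · refine hasFDerivAt_of_tendstoLocallyUniformly hW' (fun N x => ?_) fun x => hW.tendsto_apply x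
    exact (hasFDerivAt_moll (hη.of_le (by exact_mod_cast le_top)) hη0 (by positivity) hwi
      x).const_smul _
  · filter_upwards [ae_tendsto_moll hη.continuous hη0 hη1 hb hw hwb] with x hx
    exact tendsto_nhds_unique hx (hW.tendsto_apply x)

end

section

open Filter MeasureTheory
open scoped Topology ContDiff
variable {n : ℕ}

theorem exists_norm_moll_mul_sub_le {F : Type*} [NormedAddCommGroup F] [NormedSpace ℝ F]
    {k : Euc n → F} (hk : Continuous k) (hk0 : ∀ z, 1 < ‖z‖ → k z = 0)
    {a p : Euc n → ℝ} (ha : ContDiff ℝ 1 a) (hp : Continuous p) (ρ : ℝ) :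
    ∃ C, ∀ s x, 1 ≤ s → ‖x‖ < ρ →
      ‖s ^ n • moll k s (fun y => a y * p y) x - a x • s ^ n • moll k s p x‖ ≤ C * s⁻¹ := by
  obtain ⟨C, hC⟩ := (hasCompactSupport_of_one_lt_norm hk0).exists_bound_of_continuous hk
  obtain ⟨P, hP⟩ := (isCompact_closedBall (0 : Euc n) (ρ + 1)).exists_bound_of_continuousOn
    hp.continuousOn
  obtain ⟨A, hA⟩ := (isCompact_closedBall (0 : Euc n) (ρ + 1)).exists_bound_of_continuousOn
    (ha.continuous_fderiv one_ne_zero).continuousOn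
  refine ⟨A * P * C * volume.real (Metric.closedBall (0 : Euc n) 1), fun s x hs hx => ?_⟩
  have hs0 : 0 < s := one_pos.trans_le hs
  have hac := ha.continuous
  have hcs : HasCompactSupport fun y => k (s • (x - y)) := hasCompactSupport_comp_affine hk0 hs0 x
  have e : s ^ n • moll k s (fun y => a y * p y) x - a x • s ^ n • moll k s p x
      = s ^ n • moll k s (fun y => (a y - a x) * p y) x := by
    rw [smul_comm (a x), ← smul_sub]
    simp only [moll, sub_mul, sub_smul]
    rw [integral_sub, ← integral_smul]
    · simp only [smul_smul]
    · exact (by fun_prop : Continuous fun y =>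
        (a y * p y) • k (s • (x - y))).integrable_of_hasCompactSupport hcs.smul_left
    · exact (by fun_prop : Continuous fun y =>
        (a x * p y) • k (s • (x - y))).integrable_of_hasCompactSupport hcs.smul_left
  have h1 : 1 / s ≤ 1 := by rw [div_le_one (by positivity)]; exact hs
  rw [e]
  refine (norm_moll_le hk0 hC hs0 (B := A * s⁻¹ * P) fun y hy => ?_).trans_eq (by ring)
  have hy1 : ‖y‖ ≤ ρ + 1 := by
    have := norm_sub_le x (x - y)
    rw [sub_sub_cancel] at this
    linarith
  have hy' := mem_closedBall_zero_iff.2 hy1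
  have hx' : x ∈ Metric.closedBall (0 : Euc n) (ρ + 1) :=
    mem_closedBall_zero_iff.2 (by linarith)
  have hLip := (convex_closedBall (0 : Euc n) (ρ + 1)).norm_image_sub_le_of_norm_fderiv_le
    (fun z _ => ha.differentiable one_ne_zero z) hA hx' hy'
  have hA0 : 0 ≤ A := (norm_nonneg _).trans (hA x hx')
  rw [norm_sub_rev y x] at hLip
  rw [abs_mul]
  refine mul_le_mul (hLip.trans ?_) (hP y hy') (abs_nonneg _) (by positivity)
  rw [← one_div]
  exact mul_le_mul_of_nonneg_left hy hA0

theorem tendstoLocallyUniformly_const {G : Type*} [UniformSpace G] (f : Euc n → G) :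
    TendstoLocallyUniformly (fun _ : ℕ => f) f atTop := fun _ hu _ =>
  ⟨Set.univ, univ_mem, .of_forall fun _ _ _ => refl_mem_uniformity hu⟩

theorem tendstoLocallyUniformly_of_sub_smul {G : Type*} [NormedAddCommGroup G] [NormedSpace ℝ G]
    {d e : ℕ → Euc n → G} {L E : Euc n → G} {a : Euc n → ℝ}
    (hd : TendstoLocallyUniformly (fun N x => d N x - a x • e N x) L atTop)
    (he : TendstoLocallyUniformly e E atTop) (ha : Continuous a) (hE : Continuous E) :
    TendstoLocallyUniformly d (fun x => L x + a x • E x) atTop := by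
  have := hd.add ((tendstoLocallyUniformly_const a).smul₀ he ha hE)
  convert this using 1
  · ext1 N
    ext1 x
    simp
  · rfl

theorem moll_fderiv_eq_avg {η v : Euc n → ℝ} (hη : ContDiff ℝ ∞ η)
    (hη0 : ∀ z, 1 < ‖z‖ → η z = 0) (hv : ContDiff ℝ 1 v) {s : ℝ} (hs : 0 < s) (x : Euc n) :
    s ^ n • s • moll (fderiv ℝ η) s v x = avg η s⁻¹ (fderiv ℝ v) x := by
  have h1 := (hasFDerivAt_moll (hη.of_le (by exact_mod_cast le_top)) hη0 hs
    hv.continuous.locallyIntegrable x).const_smul (s ^ n)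
  have e : s ^ n • moll η s v = avg η s⁻¹ v := funext fun x => moll_eq_avg η hs v x
  rw [e] at h1
  exact h1.unique (hasFDerivAt_avg hη.continuous hη0 hv s⁻¹ x)

theorem moll_fderiv_fderiv_eq_avg {η v : Euc n → ℝ} (hη : ContDiff ℝ ∞ η)
    (hη0 : ∀ z, 1 < ‖z‖ → η z = 0) (hv : ContDiff ℝ 2 v) {s : ℝ} (hs : 0 < s) (x : Euc n) :
    s ^ n • s • s • moll (fderiv ℝ (fderiv ℝ η)) s v x
      = avg η s⁻¹ (fderiv ℝ (fderiv ℝ v)) x := by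
  have hη' := (contDiff_infty_iff_fderiv.1 hη).2
  have h1 := ((hasFDerivAt_moll (hη'.of_le (by exact_mod_cast le_top))
    (fun z => fderiv_eq_zero_of_one_lt_norm hη0) hs
    hv.continuous.locallyIntegrable x).const_smul s).const_smul (s ^ n)
  have e : s ^ n • s • moll (fderiv ℝ η) s v = avg η s⁻¹ (fderiv ℝ v) := funext fun x =>
    moll_fderiv_eq_avg hη hη0 (hv.of_le one_le_two) hs x
  rw [e] at h1
  exact h1.unique
    (hasFDerivAt_avg hη.continuous hη0 (hv.fderiv_right (by norm_num)) s⁻¹ x)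

/-- A continuous weak solution of `ΔW = a Δv`, with `a` of class `C¹` and `v` of class `C²`,
is of class `C²`. -/
theorem contDiff_two_of_weak_solution (hn : 3 ≤ n) {W a v : Euc n → ℝ} (hW : Continuous W)
    (ha : ContDiff ℝ 1 a) (hv : ContDiff ℝ 2 v)
    (hwq : ∀ ψ : Euc n → ℝ, ContDiff ℝ 2 ψ → HasCompactSupport ψ →
      ∫ x, lap ψ x * W x = ∫ x, ψ x * (a x * lap v x)) : ContDiff ℝ 2 W := by
  obtain ⟨η, ζ, hη, hζ, hη0, hζ0, hη1, hζη⟩ := exists_kernel hn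
  have hl : Continuous (lap v) := continuous_lap hv
  have hac := ha.continuous
  have hq : Continuous fun x => a x * lap v x := hac.mul hl
  have hη' := (contDiff_infty_iff_fderiv.1 hη).2
  have hζ' := (contDiff_infty_iff_fderiv.1 hζ).2
  have hη0' : ∀ z, 1 < ‖z‖ → fderiv ℝ η z = 0 := fun z => fderiv_eq_zero_of_one_lt_norm hη0
  have hζ0' : ∀ z, 1 < ‖z‖ → fderiv ℝ ζ z = 0 := fun z => fderiv_eq_zero_of_one_lt_norm hζ0
  have hv'' : Continuous (fderiv ℝ (fderiv ℝ v)) :=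
    (hv.fderiv_right (m := 1) (by norm_num)).continuous_fderiv one_ne_zero
  have ht : Tendsto (fun N : ℕ => ((2 : ℝ) ^ N)⁻¹) atTop (𝓝 0) := by
    simp only [← inv_pow]
    exact tendsto_pow_atTop_nhds_zero_of_lt_one (by norm_num) (by norm_num)
  have hA : TendstoLocallyUniformly (fun N : ℕ => ((2 : ℝ) ^ N) ^ n • moll η (2 ^ N) W) W atTop := by
    have : (fun N : ℕ => ((2 : ℝ) ^ N) ^ n • moll η (2 ^ N) W)
        = fun N : ℕ => avg η ((2 : ℝ) ^ N)⁻¹ W := by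
      ext N x
      exact moll_eq_avg η (by positivity) W x
    rw [this]
    exact tendstoLocallyUniformly_avg hη.continuous hη0 hη1 hW ht
  obtain ⟨W', hW'⟩ := exists_tendstoLocallyUniformly_moll_fderiv hη hη0 hζ hζ0 hζη hW.abs
    hW.measurable (fun x => le_rfl) hq.locallyIntegrable hwq hq.abs fun x => le_rfl
  let D (N : ℕ) (u : Euc n → ℝ) (x : Euc n) :=
    ((2 : ℝ) ^ N) ^ n • (2 : ℝ) ^ N • (2 : ℝ) ^ N • moll (fderiv ℝ (fderiv ℝ η)) (2 ^ N) u x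
  have hDv : TendstoLocallyUniformly (fun N x => D N v x) (fderiv ℝ (fderiv ℝ v)) atTop := by
    have : (fun N x => D N v x) = fun N : ℕ => avg η ((2 : ℝ) ^ N)⁻¹ (fderiv ℝ (fderiv ℝ v)) := by
      ext1 N
      ext1 x
      exact moll_fderiv_fderiv_eq_avg hη hη0 hv (by positivity) x
    rw [this]
    exact tendstoLocallyUniformly_avg hη.continuous hη0 hη1 hv'' ht
  have hDF : ∃ L : Euc n → Euc n →L[ℝ] Euc n →L[ℝ] ℝ, TendstoLocallyUniformly (fun N x => D N W x - a x • D N v x)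
      L atTop := by
    refine exists_tendstoLocallyUniformly_of_geometric (G := Euc n →L[ℝ] Euc n →L[ℝ] ℝ) fun ρ => ?_
    obtain ⟨C, hC⟩ := exists_norm_moll_mul_sub_le (hζ'.continuous_fderiv (by simp))
      (fun z => fderiv_eq_zero_of_one_lt_norm hζ0') ha hl ρ
    refine ⟨C, fun j x hx => ?_⟩
    have h1 := moll_fderiv_fderiv_sub_moll_fderiv_fderiv hη hη0 hζ hζ0 hζη hW.abs hW.measurable
      (fun x => le_rfl) hq.locallyIntegrable hwq (s := 2 ^ j) (by positivity) x
    have h2 := moll_fderiv_fderiv_sub_moll_fderiv_fderiv hη hη0 hζ hζ0 hζη hv.continuous.abs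
      hv.continuous.measurable (fun x => le_rfl) hl.locallyIntegrable
      (fun ψ hψ hs => integral_lap_mul hv hψ hs) (s := 2 ^ j) (by positivity) x
    rw [← pow_succ'] at h1 h2
    have h3 := hC (2 ^ j) x (one_le_pow₀ (by norm_num)) hx
    rw [← h1, ← h2, ← inv_pow, ← one_div] at h3
    convert h3 using 2
    simp only [D, smul_sub]
    abel
  obtain ⟨L, hL⟩ := hDF
  have hD : TendstoLocallyUniformly (fun N x => D N W x)
      (fun x => L x + a x • fderiv ℝ (fderiv ℝ v) x) atTop := by
    exact tendstoLocallyUniformly_of_sub_smul (G := Euc n →L[ℝ] Euc n →L[ℝ] ℝ) hL hDv hac hv''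
  have hWi : LocallyIntegrable W := hW.locallyIntegrable
  have hη'1 : ContDiff ℝ 1 (fderiv ℝ η) := hη'.of_le (by exact_mod_cast le_top)
  have hη''1 : ContDiff ℝ 1 (fderiv ℝ (fderiv ℝ η)) :=
    (contDiff_infty_iff_fderiv.1 hη').2.of_le (by exact_mod_cast le_top)
  have hWd : ∀ x, HasFDerivAt W (W' x) x :=
    hasFDerivAt_of_tendstoLocallyUniformly hW' (fun N x => (hasFDerivAt_moll
      (hη.of_le (by exact_mod_cast le_top)) hη0 (by positivity) hWi x).const_smul _)
      fun x => hA.tendsto_apply x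
  have hWd' : ∀ x, HasFDerivAt W' (L x + a x • fderiv ℝ (fderiv ℝ v) x) x :=
    hasFDerivAt_of_tendstoLocallyUniformly hD (fun N x => ((hasFDerivAt_moll
      hη'1 hη0' (by positivity) hWi x).const_smul _).const_smul _) fun x => hW'.tendsto_apply x
  have hc : Continuous fun x => L x + a x • fderiv ℝ (fderiv ℝ v) x := by
    refine hD.continuous (Frequently.of_forall fun N => ?_)
    have : Continuous (moll (fderiv ℝ (fderiv ℝ η)) (2 ^ N) W) :=
      continuous_iff_continuousAt.2 fun x => (hasFDerivAt_moll hη''1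
        (fun z => fderiv_eq_zero_of_one_lt_norm hη0') (by positivity) hWi x).continuousAt
    exact ((this.const_smul ((2 : ℝ) ^ N)).const_smul ((2 : ℝ) ^ N)).const_smul (((2 : ℝ) ^ N) ^ n)
  exact (contDiff_succ_iff_hasFDerivAt (n := 1)).2
    ⟨W', contDiff_one_iff_hasFDerivAt.2 ⟨_, hc, hWd'⟩, hWd⟩

theorem lap_eq_of_weak_solution {W q : Euc n → ℝ} (hW : ContDiff ℝ 2 W) (hq : Continuous q)
    (hwq : ∀ ψ : Euc n → ℝ, ContDiff ℝ 2 ψ → HasCompactSupport ψ →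
      ∫ x, lap ψ x * W x = ∫ x, ψ x * q x) (x : Euc n) : lap W x = q x := by
  have hl := continuous_lap hW
  have h := ae_eq_of_integral_contDiff_smul_eq (μ := (volume : Measure (Euc n)))
    hl.locallyIntegrable hq.locallyIntegrable fun g hg hs => by
      have hg2 : ContDiff ℝ 2 g := hg.of_le ENat.LEInfty.out
      simp only [smul_eq_mul]
      rw [← hwq g hg2 hs, integral_lap_mul hW hg2 hs]
  exact congrFun ((hl.ae_eq_iff_eq volume hq).1 h) x

theorem nonneg_of_forall_integral_mul_nonneg {f : Euc n → ℝ} (hf : Continuous f)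
    (h : ∀ ψ : Euc n → ℝ, Continuous ψ → HasCompactSupport ψ → (∀ x, 0 ≤ ψ x) →
      0 ≤ ∫ x, ψ x * f x) (x : Euc n) : 0 ≤ f x := by
  by_contra! hx
  let ψ : Euc n → ℝ := fun y => max 0 (-f y) * max 0 (1 - ‖y - x‖)
  have hψ : Continuous ψ := by fun_prop
  have hψs : HasCompactSupport ψ := by
    refine HasCompactSupport.intro (isCompact_closedBall x 1) fun y hy => ?_
    rw [Metric.mem_closedBall, not_le, dist_eq_norm] at hy
    simp only [ψ]
    rw [max_eq_left (by linarith : 1 - ‖y - x‖ ≤ 0), mul_zero]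
  have hψ0 : ∀ y, 0 ≤ ψ y := fun y => mul_nonneg (le_max_left _ _) (le_max_left _ _)
  have h1 := h ψ hψ hψs hψ0
  have hpos : 0 < ∫ y, ψ y * -f y := by
    refine (hψ.mul hf.neg).integral_pos_of_hasCompactSupport_nonneg_nonzero hψs.mul_right
      (fun y => ?_) (x := x) ?_
    · rcases le_total (f y) 0 with hy | hy
      · exact mul_nonneg (hψ0 y) (by simpa using hy)
      · have : ψ y = 0 := by simp [ψ, max_eq_left (by linarith : -f y ≤ 0)]
        simp [this]
    · have : ψ x = -f x := by simp [ψ, hx.le]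
      rw [this]
      exact mul_ne_zero (by simpa using hx.ne) (by simpa using hx.ne)
  simp only [mul_neg, integral_neg] at hpos
  linarith

/-- The positive part of the strong minimum principle: a solution of `c ΔW = R W` that is positive
on a sphere is positive on the ball. -/
theorem pos_of_pos_sphere (hn : 0 < n) {c : ℝ} (hc : 0 < c) {R W : Euc n → ℝ} (hRc : Continuous R)
    (hR : ∀ x, 0 ≤ R x) (hW : ContDiff ℝ 2 W) (hWR : ∀ x, c * lap W x = R x * W x) {ρ : ℝ}
    (hρ : 0 < ρ) (hWρ : ∀ x, ‖x‖ = ρ → 0 < W x) (x : Euc n) (hx : ‖x‖ ≤ ρ) : 0 < W x := by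
  obtain ⟨δ, hδ, hδW⟩ := (isCompact_sphere (0 : Euc n) ρ).exists_forall_le'
    hW.continuous.continuousOn (a := 0) fun y hy => hWρ y (by simpa using hy)
  obtain ⟨M, hM⟩ := (isCompact_closedBall (0 : Euc n) ρ).exists_bound_of_continuousOn
    hRc.continuousOn
  have hM0 : 0 ≤ M := (norm_nonneg _).trans (hM 0 (by simpa using hρ.le))
  have hn' : (0 : ℝ) < n := by exact_mod_cast hn
  obtain ⟨A, hA0, hA⟩ : ∃ A : ℝ, 0 ≤ A ∧ c * (2 * n * A) = M + 1 :=
    ⟨(M + 1) / (c * (2 * n)), by positivity, by field_simp⟩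
  let h : ℝ → ℝ := fun t => δ * Real.exp (A * (t - ρ ^ 2))
  have hh : ContDiff ℝ 2 h := by fun_prop
  have hd : deriv h = fun t => A * h t := funext fun t => by
    have h1 : HasDerivAt (fun t : ℝ => A * (t - ρ ^ 2)) A t := by
      simpa using ((hasDerivAt_id t).sub_const (ρ ^ 2)).const_mul A
    rw [(h1.exp.const_mul δ).deriv]
    simp only [h]
    ring
  have hd2 : ∀ t, deriv (deriv h) t = A * (A * h t) := fun t => by
    conv_lhs => rw [hd]
    rw [deriv_const_mul _ (hh.differentiable two_ne_zero t), hd]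
  let s : Euc n → ℝ := fun x => h (‖x‖ ^ 2)
  have hs : ContDiff ℝ 2 s := hh.comp (contDiff_norm_sq ℝ)
  have hs0 : ∀ x, 0 < s x := fun x => mul_pos hδ (Real.exp_pos _)
  have hls : ∀ x, lap s x = (2 * n * A + 4 * ‖x‖ ^ 2 * A ^ 2) * s x := fun x => by
    have := lap_radial (n := n) hh x
    rw [hd2, hd] at this
    simp only [s]
    rw [this]
    ring
  obtain ⟨x₀, hx₀, hmin⟩ := (isCompact_closedBall (0 : Euc n) ρ).exists_isMinOn
    ⟨0, by simpa using hρ.le⟩ (hW.sub hs).continuous.continuousOn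
  have hx₀' : ‖x₀‖ ≤ ρ := by simpa using hx₀
  suffices hge : 0 ≤ W x₀ - s x₀ by
    have : W x₀ - s x₀ ≤ W x - s x := hmin (by simpa using hx)
    linarith [hs0 x]
  by_contra! hlt
  have hlt' : ‖x₀‖ < ρ := by
    refine hx₀'.lt_of_ne fun he => ?_
    have h1 := hδW x₀ (by simpa using he)
    have h2 : s x₀ = δ := by simp [s, h, he]
    linarith
  have hloc : IsLocalMin (fun x => W x - s x) x₀ :=
    hmin.isLocalMin (Metric.closedBall_mem_nhds_of_mem (by simpa using hlt'))
  have hlap := lap_nonneg_of_isLocalMin (hW.sub hs) hloc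
  rw [lap_sub hW hs] at hlap
  have h1 := hM x₀ hx₀
  rw [Real.norm_of_nonneg (hR x₀)] at h1
  have h2 : R x₀ * W x₀ ≤ M * s x₀ :=
    (mul_le_mul_of_nonneg_left (by linarith) (hR x₀)).trans
      (mul_le_mul_of_nonneg_right h1 (hs0 x₀).le)
  have h3 : (M + 1) * s x₀ ≤ c * lap s x₀ := by
    rw [hls, ← hA]
    have : 0 ≤ c * (4 * ‖x₀‖ ^ 2 * A ^ 2) * s x₀ := by
      have := hs0 x₀
      positivity
    linarith
  have h4 := hWR x₀
  have h5 := mul_nonneg hc.le hlap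
  nlinarith [hs0 x₀]

/-- Between a `C²` supersolution `φ` and `v ≤ φ` with `c Δv = R φ` lies a `C²` solution of
`c ΔW = R W`. -/
theorem exists_solution_between (hn : 3 ≤ n) {c : ℝ} (hc : 0 < c) {R φ v : Euc n → ℝ}
    (hRc : Continuous R) (hR : ∀ x, 0 ≤ R x) (hφ : ContDiff ℝ 2 φ) (hv : ContDiff ℝ 2 v)
    (hφpos : ∀ x, 0 < φ x) (hvφ : ∀ x, v x ≤ φ x) (hsuper : ∀ x, c * lap φ x ≤ R x * φ x)
    (hveq : ∀ x, c * lap v x = R x * φ x) :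
    ∃ W : Euc n → ℝ, ContDiff ℝ 2 W ∧ (∀ x, c * lap W x = R x * W x) ∧
      ∀ x, v x ≤ W x ∧ W x ≤ φ x := by
  obtain ⟨w, hw, hwb, hweak, hcmp⟩ := exists_weak_solution (by omega) hc hRc hR hφ hv hφpos hvφ
    hsuper fun x => (mul_le_mul_of_nonneg_left (hvφ x) (hR x)).trans_eq (hveq x).symm
  have hφc := hφ.continuous
  have hb : Continuous fun x => φ x + 1 := by fun_prop
  have hweak' : ∀ ψ : Euc n → ℝ, ContDiff ℝ 2 ψ → HasCompactSupport ψ →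
      ∫ x, lap ψ x * w x = ∫ x, ψ x * (c⁻¹ * (R x * w x)) := fun ψ hψ hs => by
    have e : ∀ x, ψ x * (c⁻¹ * (R x * w x)) = c⁻¹ * (ψ x * (R x * w x)) := fun x => by ring
    simp only [e]
    rw [integral_const_mul, ← hweak ψ hψ hs, inv_mul_cancel_left₀ hc.ne']
  obtain ⟨W, hW1, hwW⟩ := exists_contDiff_one_ae_eq hn hb hw hwb
    ((hRc.measurable.mul hw).const_mul c⁻¹)
    (by fun_prop : Continuous fun x => c⁻¹ * (R x * (φ x + 1)))
    (fun x => by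
      show |c⁻¹ * (R x * w x)| ≤ _
      rw [abs_mul, abs_mul, abs_of_nonneg (hR x), abs_of_nonneg (inv_nonneg.2 hc.le)]
      exact mul_le_mul_of_nonneg_left (mul_le_mul_of_nonneg_left (hwb x) (hR x))
        (inv_nonneg.2 hc.le)) hweak'
  have hWc := hW1.continuous
  have hlv : ∀ x, W x / φ x * lap v x = c⁻¹ * (R x * W x) := fun x => by
    have h1 := hveq x
    have h2 := (hφpos x).ne'
    field_simp
    linear_combination W x * h1
  have hweakW : ∀ ψ : Euc n → ℝ, ContDiff ℝ 2 ψ → HasCompactSupport ψ →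
      ∫ x, lap ψ x * W x = ∫ x, ψ x * (c⁻¹ * (R x * W x)) := fun ψ hψ hs => by
    have e1 : ∫ x, lap ψ x * W x = ∫ x, lap ψ x * w x :=
      integral_congr_ae (hwW.mono fun x hx => by simp only [hx])
    have e2 : ∫ x, ψ x * (c⁻¹ * (R x * W x)) = ∫ x, ψ x * (c⁻¹ * (R x * w x)) :=
      integral_congr_ae (hwW.mono fun x hx => by simp only [hx])
    rw [e1, e2, hweak' ψ hψ hs]
  have hW : ContDiff ℝ 2 W := by
    refine contDiff_two_of_weak_solution (a := fun x => W x / φ x) hn hWc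
      (hW1.div (hφ.of_le one_le_two) fun x => (hφpos x).ne') hv fun ψ hψ hs => ?_
    simp only [hlv]
    exact hweakW ψ hψ hs
  have hcmpW : ∀ ψ : Euc n → ℝ, ∫ x, ψ x * w x = ∫ x, ψ x * W x := fun ψ =>
    integral_congr_ae (hwW.mono fun x hx => by simp only [hx])
  have hint : ∀ {ψ u : Euc n → ℝ}, Continuous ψ → HasCompactSupport ψ → Continuous u →
      Integrable fun x => ψ x * u x := fun hψ hs hu =>
    (hψ.mul hu).integrable_of_hasCompactSupport hs.mul_right
  refine ⟨W, hW, fun x => ?_, fun x => ⟨?_, ?_⟩⟩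
  · rw [lap_eq_of_weak_solution hW (by fun_prop) hweakW x, mul_inv_cancel_left₀ hc.ne']
  · refine sub_nonneg.1 (nonneg_of_forall_integral_mul_nonneg (f := fun x => W x - v x)
      (hWc.sub hv.continuous) (fun ψ hψ hs h0 => ?_) x)
    simp only [mul_sub]
    rw [integral_sub (hint hψ hs hWc) (hint hψ hs hv.continuous), ← hcmpW]
    exact sub_nonneg.2 (hcmp ψ hψ hs h0).2.2
  · refine sub_nonneg.1 (nonneg_of_forall_integral_mul_nonneg (f := fun x => φ x - W x)
      (hφc.sub hWc) (fun ψ hψ hs h0 => ?_) x)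
    simp only [mul_sub]
    rw [integral_sub (hint hψ hs hφc) (hint hψ hs hWc), ← hcmpW]
    exact sub_nonneg.2 (hcmp ψ hψ hs h0).2.1

end

/-- Property (H) implies the existence of a positive solution `w ≤ φ` of `-c_n Δw + R₀ w = 0`
with `w ≥ (1-θ)φ` near infinity. -/
theorem property_H_yamabe (n : ℕ) (hn : 3 ≤ n)
    (R₀ : EuclideanSpace ℝ (Fin n) → ℝ) (hR₀c : Continuous R₀) (hR₀ : ∀ x, 0 ≤ R₀ x)
    (φ : EuclideanSpace ℝ (Fin n) → ℝ) (hφ : ContDiff ℝ 2 φ) (hφpos : ∀ x, 0 < φ x)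
    (hf : ∀ x, 0 ≤ -(4 * ((n : ℝ) - 1) / ((n : ℝ) - 2)) * lap φ x + R₀ x * φ x)
    (ubar : EuclideanSpace ℝ (Fin n) → ℝ) (hubar : ContDiff ℝ 2 ubar)
    (hubarpos : ∀ x, 0 < ubar x)
    (hubareq : ∀ x, -(4 * ((n : ℝ) - 1) / ((n : ℝ) - 2)) * lap ubar x
      = -(4 * ((n : ℝ) - 1) / ((n : ℝ) - 2)) * lap φ x + R₀ x * φ x)
    (θ : ℝ) (hθ : θ ∈ Set.Ioo (0 : ℝ) 1)
    (K : Set (EuclideanSpace ℝ (Fin n))) (hK : IsCompact K)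
    (hubarθ : ∀ x ∉ K, ubar x ≤ θ * φ x) :
    ∃ w : EuclideanSpace ℝ (Fin n) → ℝ, ContDiff ℝ 2 w ∧
      (∀ x, 0 < w x ∧ w x ≤ φ x) ∧
      (∀ x, -(4 * ((n : ℝ) - 1) / ((n : ℝ) - 2)) * lap w x + R₀ x * w x = 0) ∧
      (∀ x ∉ K, (1 - θ) * φ x ≤ w x) := by
  have hn' : (3 : ℝ) ≤ n := by exact_mod_cast hn
  have hc : 0 < 4 * ((n : ℝ) - 1) / ((n : ℝ) - 2) := div_pos (by linarith) (by linarith)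
  generalize 4 * ((n : ℝ) - 1) / ((n : ℝ) - 2) = c at *
  obtain ⟨W, hW, hWR, hWb⟩ := exists_solution_between hn hc hR₀c hR₀ hφ (hφ.sub hubar) hφpos
    (fun x => sub_le_self _ (hubarpos x).le) (fun x => by linarith [hf x]) fun x => by
      rw [lap_sub hφ hubar]
      linarith [hubareq x]
  have hout : ∀ x ∉ K, (1 - θ) * φ x ≤ W x := fun x hx => by
    linarith [hubarθ x hx, (hWb x).1]
  have hout' : ∀ x ∉ K, 0 < W x := fun x hx =>
    (mul_pos (sub_pos.2 hθ.2) (hφpos x)).trans_le (hout x hx)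
  obtain ⟨ρ, hρ⟩ := hK.isBounded.subset_ball 0
  have hρK : ∀ x : Euc n, max ρ 1 ≤ ‖x‖ → x ∉ K := fun x hx hxK => by
    have := hρ hxK
    rw [mem_ball_zero_iff] at this
    exact absurd (le_max_left ρ 1) (by linarith)
  refine ⟨W, hW, fun x => ⟨?_, (hWb x).2⟩, fun x => by linarith [hWR x], hout⟩
  rcases le_total ‖x‖ (max ρ 1) with hx | hx
  · exact pos_of_pos_sphere (by omega) hc hR₀c hR₀ hW hWR (by positivity)
      (fun y hy => hout' y (hρK y hy.ge)) x hx
  · exact hout' x (hρK x hx)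
end

section
/- Let n ≥ 3, m := (n−2)/(n+2), c_n := 4(n−1)/(n−2), and T > 0. Let u, v : [0,T] × ℝ^n → ℝ be smooth positive functions satisfying ∂_t u = c_n Δ_x (u^m) and ∂_t v = c_n Δ_x (v^m) on [0,T] × ℝ^n, and suppose there is R₀ > 0 such that u(t,x) = v(t,x) whenever ‖x‖ ≥ R₀ (for all t ∈ [0,T]). If u(0,x) = v(0,x) for all x ∈ ℝ^n, then u(t,x) = v(t,x) for all (t,x) ∈ [0,T] × ℝ^n. -/
open Filter MeasureTheory

theorem deriv_deriv_nonpos_of_isLocalMax {g : ℝ → ℝ} {a : ℝ} (hg : IsLocalMax g a)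
    (hc : ContinuousAt g a) : deriv (deriv g) a ≤ 0 := by
  by_contra! h
  have hmin : IsLocalMin g a := isLocalMin_of_deriv_deriv_pos h hg.deriv_eq_zero hc
  have heq : g =ᶠ[nhds a] fun _ => g a := by
    filter_upwards [hg, hmin] with y h₁ h₂ using le_antisymm h₁ h₂
  have h0 := heq.deriv.deriv_eq
  simp at h0
  exact h.ne' h0

section Laplacian

variable {n : ℕ} {f g : EuclideanSpace ℝ (Fin n) → ℝ} {x : EuclideanSpace ℝ (Fin n)}

theorem ContDiff.differentiable_fderiv_apply_const (hf : ContDiff ℝ 2 f)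
    (e : EuclideanSpace ℝ (Fin n)) : Differentiable ℝ (fun y => fderiv ℝ f y e) :=
  ((hf.fderiv_right (m := 1) (by norm_num)).clm_apply contDiff_const).differentiable (by norm_num)

theorem lap_nonpos_of_isLocalMax (hf : ContDiff ℝ 2 f) (hx : IsLocalMax f x) :
    lap f x ≤ 0 := by
  refine Finset.sum_nonpos fun i _ => ?_
  set e : EuclideanSpace ℝ (Fin n) := EuclideanSpace.single i 1
  have hline (s : ℝ) : HasDerivAt (fun s : ℝ => x + s • e) e s := by
    simpa using ((hasDerivAt_id s).smul_const e).const_add x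
  have h₁ : deriv (fun s : ℝ => f (x + s • e)) = fun s => fderiv ℝ f (x + s • e) e := by
    funext s
    exact ((hf.differentiable (by norm_num) _).hasFDerivAt.comp_hasDerivAt s (hline s)).deriv
  have h₂ : deriv (fun s : ℝ => fderiv ℝ f (x + s • e) e) 0 =
      fderiv ℝ (fun y => fderiv ℝ f y e) x e := by
    have h := ((hf.differentiable_fderiv_apply_const e
      (x + (0 : ℝ) • e)).hasFDerivAt.comp_hasDerivAt 0 (hline 0)).deriv
    rw [zero_smul, add_zero] at h
    exact h
  have hcont : ContinuousAt (fun s : ℝ => x + s • e) 0 := (hline 0).continuousAt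
  have hmax : IsLocalMax (fun s : ℝ => f (x + s • e)) 0 := by
    have hx' : IsLocalMax f (x + (0 : ℝ) • e) := by simpa using hx
    exact hcont.eventually hx'
  have := deriv_deriv_nonpos_of_isLocalMax hmax
    (hf.continuous.continuousAt.comp hcont)
  rwa [h₁, h₂] at this

theorem lap_sub_const_mul (hf : ContDiff ℝ 2 f) (hg : ContDiff ℝ 2 g) (r : ℝ) :
    lap (fun y => f y - r * g y) x = lap f x - r * lap g x := by
  simp only [lap, Finset.mul_sum, ← Finset.sum_sub_distrib]
  refine Finset.sum_congr rfl fun i _ => ?_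
  set e : EuclideanSpace ℝ (Fin n) := EuclideanSpace.single i 1
  have h₁ : (fun y => fderiv ℝ (fun z => f z - r * g z) y e) =
      fun y => fderiv ℝ f y e - r * fderiv ℝ g y e := by
    funext y
    have := ((hf.differentiable (by norm_num) y).hasFDerivAt.sub
      ((hg.differentiable (by norm_num) y).hasFDerivAt.const_mul r)).fderiv
    change fderiv ℝ (fun z => f z - r * g z) y = _ at this
    simp [this]
  have h₂ := ((hf.differentiable_fderiv_apply_const e x).hasFDerivAt.sub
    ((hg.differentiable_fderiv_apply_const e x).hasFDerivAt.const_mul r)).fderiv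
  change fderiv ℝ (fun y => fderiv ℝ f y e - r * fderiv ℝ g y e) x = _ at h₂
  rw [h₁, h₂]
  simp

/-- At a maximum point of `f / g`, the Laplacian of `f` is at most `f / g` times that of `g`. -/
theorem lap_le_div_mul_lap (hf : ContDiff ℝ 2 f) (hg : ContDiff ℝ 2 g) (hpos : ∀ y, 0 < g y)
    (hx : ∀ y, f y / g y ≤ f x / g x) : lap f x ≤ f x / g x * lap g x := by
  have hmax : IsLocalMax (fun y => f y - f x / g x * g y) x := by
    refine Eventually.of_forall fun y => ?_
    have h := (div_le_iff₀ (hpos y)).1 (hx y)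
    have h' := div_mul_cancel₀ (f x) (hpos x).ne'
    simp only
    linarith
  have := lap_nonpos_of_isLocalMax (hf.sub (contDiff_const.mul hg)) hmax
  rw [lap_sub_const_mul hf hg] at this
  linarith

end Laplacian

theorem HasDerivWithinAt.nonneg_of_isMaxOn_Icc {g : ℝ → ℝ} {g' T t : ℝ} (ht : t ∈ Set.Ioc 0 T)
    (hg : HasDerivWithinAt g g' (Set.Icc 0 T) t) (hmax : IsMaxOn g (Set.Icc 0 T) t) : 0 ≤ g' := by
  have h := hmax.localize.hasFDerivWithinAt_nonpos hg.hasFDerivWithinAt (y := 0 - t)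
    (sub_mem_posTangentConeAt_of_segment_subset
      ((convex_Icc 0 T).segment_subset ⟨ht.1.le, ht.2⟩ ⟨le_rfl, ht.1.le.trans ht.2⟩))
  simp at h
  exact nonneg_of_mul_nonneg_right h ht.1

section TimeSlab

variable {n : ℕ} {T : ℝ} {u v : ℝ × EuclideanSpace ℝ (Fin n) → ℝ}

theorem contDiff_slice_rpow (hu : ContDiffOn ℝ (⊤ : ℕ∞) u (Set.Icc 0 T ×ˢ Set.univ))
    (hupos : ∀ t ∈ Set.Icc (0 : ℝ) T, ∀ x, 0 < u (t, x)) (m : ℝ) {t : ℝ}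
    (ht : t ∈ Set.Icc 0 T) : ContDiff ℝ 2 (fun y => u (t, y) ^ m) := by
  have h : ContDiff ℝ (⊤ : ℕ∞) (fun y => u (t, y)) :=
    hu.comp_contDiff (contDiff_const.prodMk contDiff_id) fun y => ⟨ht, trivial⟩
  exact (h.rpow_const_of_ne fun y => (hupos t ht y).ne').of_le
    (WithTop.coe_le_coe.2 (le_top : (2 : ℕ∞) ≤ ⊤))

theorem exists_bound_log_time_deriv (hT : 0 < T)
    (hv : ContDiffOn ℝ (⊤ : ℕ∞) v (Set.Icc 0 T ×ˢ Set.univ))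
    (hvpos : ∀ t ∈ Set.Icc (0 : ℝ) T, ∀ x, 0 < v (t, x)) (R : ℝ) :
    ∃ K, 0 ≤ K ∧ ∀ t ∈ Set.Icc (0 : ℝ) T, ∀ x, ‖x‖ ≤ R → ∀ v',
      HasDerivWithinAt (fun s => v (s, x)) v' (Set.Icc 0 T) t → |v' / v (t, x)| ≤ K := by
  set S : Set (ℝ × EuclideanSpace ℝ (Fin n)) := Set.Icc 0 T ×ˢ Set.univ
  have hS : UniqueDiffOn ℝ S := (uniqueDiffOn_Icc hT).prod uniqueDiffOn_univ
  have hcont : ContinuousOn (fun p => fderivWithin ℝ v S p (1, 0) / v p) S :=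
    ((hv.continuousOn_fderivWithin hS (by simp)).clm_apply continuousOn_const).div
      hv.continuousOn fun p hp => (hvpos p.1 hp.1 p.2).ne'
  have hcomp : IsCompact (Set.Icc 0 T ×ˢ Metric.closedBall (0 : EuclideanSpace ℝ (Fin n)) R) :=
    isCompact_Icc.prod (isCompact_closedBall _ _)
  obtain ⟨K, hK⟩ := hcomp.exists_bound_of_continuousOn
    (hcont.mono (Set.prod_mono_right (Set.subset_univ _)))
  refine ⟨max K 0, le_max_right _ _, fun t ht x hx v' hv' => ?_⟩
  have hd : HasDerivWithinAt (fun s => v (s, x)) (fderivWithin ℝ v S (t, x) (1, 0))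
      (Set.Icc 0 T) t := by
    have h₁ := (hv.differentiableOn (by simp) (t, x) ⟨ht, trivial⟩).hasFDerivWithinAt
    have h₂ : HasDerivWithinAt (fun s : ℝ => (s, x)) ((1 : ℝ), (0 : EuclideanSpace ℝ (Fin n)))
        (Set.Icc 0 T) t := (hasDerivWithinAt_id t _).prodMk (hasDerivWithinAt_const t _ x)
    exact h₁.comp_hasDerivWithinAt t h₂ fun s hs => Set.mk_mem_prod hs (Set.mem_univ x)
  rw [(uniqueDiffOn_Icc hT t ht).eq_deriv _ hv' hd]
  exact (hK (t, x) ⟨ht, by simpa using hx⟩).trans (le_max_left _ _)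

/-- Comparison principle: the maximum of `exp (-λ t) * log (u / v)` cannot be positive for large
`λ`. -/
theorem le_of_porous_medium_flow {m c R : ℝ} (hm₀ : 0 < m) (hm₁ : m < 1) (hc : 0 < c)
    (hT : 0 < T)
    (hu : ContDiffOn ℝ (⊤ : ℕ∞) u (Set.Icc 0 T ×ˢ Set.univ))
    (hv : ContDiffOn ℝ (⊤ : ℕ∞) v (Set.Icc 0 T ×ˢ Set.univ))
    (hupos : ∀ t ∈ Set.Icc (0 : ℝ) T, ∀ x, 0 < u (t, x))
    (hvpos : ∀ t ∈ Set.Icc (0 : ℝ) T, ∀ x, 0 < v (t, x))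
    (huflow : ∀ t ∈ Set.Icc (0 : ℝ) T, ∀ x,
      HasDerivWithinAt (fun s => u (s, x)) (c * lap (fun y => u (t, y) ^ m) x) (Set.Icc 0 T) t)
    (hvflow : ∀ t ∈ Set.Icc (0 : ℝ) T, ∀ x,
      HasDerivWithinAt (fun s => v (s, x)) (c * lap (fun y => v (t, y) ^ m) x) (Set.Icc 0 T) t)
    (hout : ∀ t ∈ Set.Icc (0 : ℝ) T, ∀ x : EuclideanSpace ℝ (Fin n),
      R ≤ ‖x‖ → u (t, x) ≤ v (t, x))
    (hinit : ∀ x, u (0, x) ≤ v (0, x)) :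
    ∀ t ∈ Set.Icc (0 : ℝ) T, ∀ x, u (t, x) ≤ v (t, x) := by
  by_contra! hcon
  obtain ⟨t₁, ht₁, x₁, hlt⟩ := hcon
  obtain ⟨K, hK₀, hK⟩ := exists_bound_log_time_deriv hT hv hvpos R
  set L : ℝ × EuclideanSpace ℝ (Fin n) → ℝ := fun p => Real.log (u p) - Real.log (v p) with hL
  set l : ℝ := (1 - m) * K + 1
  have hLpos {t : ℝ} (ht : t ∈ Set.Icc 0 T) (x) : 0 < L (t, x) ↔ v (t, x) < u (t, x) := by
    rw [hL, sub_pos, Real.log_lt_log_iff (hvpos t ht x) (hupos t ht x)]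
  have hball {t : ℝ} (ht : t ∈ Set.Icc 0 T) (x) (h : 0 < L (t, x)) : ‖x‖ ≤ R := by
    by_contra! hx
    exact (hout t ht x hx.le).not_gt ((hLpos ht x).1 h)
  have hcont : ContinuousOn (fun p => Real.exp (-l * p.1) * L p) (Set.Icc 0 T ×ˢ Set.univ) := by
    refine ContinuousOn.mul (by fun_prop) (ContinuousOn.sub ?_ ?_)
    · exact hu.continuousOn.log fun p hp => (hupos p.1 hp.1 p.2).ne'
    · exact hv.continuousOn.log fun p hp => (hvpos p.1 hp.1 p.2).ne'
  have hL₁ := (hLpos ht₁ x₁).2 hlt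
  have hmem₁ : (t₁, x₁) ∈ Set.Icc 0 T ×ˢ Metric.closedBall (0 : EuclideanSpace ℝ (Fin n)) R :=
    ⟨ht₁, by simpa using hball ht₁ x₁ hL₁⟩
  obtain ⟨⟨t, x⟩, ⟨ht, -⟩, hmax⟩ :=
    (isCompact_Icc.prod (isCompact_closedBall _ _)).exists_isMaxOn ⟨_, hmem₁⟩
      (hcont.mono (Set.prod_mono_right (Set.subset_univ _)))
  change t ∈ Set.Icc 0 T at ht
  have hpos : 0 < L (t, x) := by
    have h : Real.exp (-l * t₁) * L (t₁, x₁) ≤ Real.exp (-l * t) * L (t, x) := hmax hmem₁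
    exact pos_of_mul_pos_right ((mul_pos (Real.exp_pos _) hL₁).trans_le h) (Real.exp_pos _).le
  have hglobal (s : ℝ) (hs : s ∈ Set.Icc 0 T) (y) :
      Real.exp (-l * s) * L (s, y) ≤ Real.exp (-l * t) * L (t, x) := by
    by_cases h : 0 < L (s, y)
    · exact hmax (show (s, y) ∈ _ from ⟨hs, by simpa using hball hs y h⟩)
    · exact (mul_nonpos_of_nonneg_of_nonpos (Real.exp_pos _).le (not_lt.1 h)).trans
        (mul_pos (Real.exp_pos _) hpos).le
  have ht₀ : 0 < t := by
    refine ht.1.lt_of_ne fun h => ?_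
    subst h
    exact (hinit x).not_gt ((hLpos ht x).1 hpos)
  set u₀ := u (t, x)
  set v₀ := v (t, x)
  have hu₀ : 0 < u₀ := hupos t ht x
  have hv₀ : 0 < v₀ := hvpos t ht x
  set u' := c * lap (fun y => u (t, y) ^ m) x
  set v' := c * lap (fun y => v (t, y) ^ m) x
  have htime : 0 ≤ (u' / u₀ - v' / v₀) - l * L (t, x) := by
    have hLd : HasDerivWithinAt (fun s => L (s, x)) (u' / u₀ - v' / v₀) (Set.Icc 0 T) t :=
      ((huflow t ht x).log hu₀.ne').sub ((hvflow t ht x).log hv₀.ne')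
    have hexp : HasDerivWithinAt (fun s : ℝ => Real.exp (-l * s)) (Real.exp (-l * t) * -l)
        (Set.Icc 0 T) t := by
      simpa using (((hasDerivAt_id t).const_mul (-l)).exp).hasDerivWithinAt (s := Set.Icc 0 T)
    have h := (hexp.mul hLd).nonneg_of_isMaxOn_Icc ⟨ht₀, ht.2⟩ fun s hs => hglobal s hs x
    refine nonneg_of_mul_nonneg_right (a := Real.exp (-l * t)) ?_ (Real.exp_pos _)
    linarith
  have hquot {y} : u (t, y) ^ m / v (t, y) ^ m = Real.exp (m * L (t, y)) := by
    rw [Real.rpow_def_of_pos (hupos t ht y), Real.rpow_def_of_pos (hvpos t ht y), ← Real.exp_sub]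
    congr 1
    simp only [hL]
    ring
  have hspace : u' ≤ Real.exp (m * L (t, x)) * v' := by
    have h := lap_le_div_mul_lap (x := x) (contDiff_slice_rpow hu hupos m ht)
      (contDiff_slice_rpow hv hvpos m ht) (fun y => Real.rpow_pos_of_pos (hvpos t ht y) m)
      (fun y => by
        rw [hquot, hquot, Real.exp_le_exp]
        exact mul_le_mul_of_nonneg_left
          (le_of_mul_le_mul_left (hglobal t ht y) (Real.exp_pos _)) hm₀.le)
    rw [hquot] at h
    calc u' ≤ c * (Real.exp (m * L (t, x)) * lap (fun y => v (t, y) ^ m) x) :=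
          mul_le_mul_of_nonneg_left h hc.le
      _ = Real.exp (m * L (t, x)) * v' := by ring
  have hu_eq : u₀ = Real.exp (L (t, x)) * v₀ := by
    simp only [hL]
    rw [Real.exp_sub, Real.exp_log hu₀, Real.exp_log hv₀, div_mul_cancel₀ _ hv₀.ne']
  set E := Real.exp (-((1 - m) * L (t, x))) with hE
  have hrate : u' / u₀ ≤ E * (v' / v₀) := by
    rw [div_le_iff₀ hu₀]
    calc u' ≤ Real.exp (m * L (t, x)) * v' := hspace
      _ = E * Real.exp (L (t, x)) * v' := by
          rw [hE, ← Real.exp_add]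
          ring_nf
      _ = E * (v' / v₀) * u₀ := by
          rw [hu_eq]
          field_simp
  have hE₁ : E ≤ 1 := Real.exp_le_one_iff.2 (by nlinarith)
  have hE₂ : 1 - E ≤ (1 - m) * L (t, x) := by
    linarith [Real.add_one_le_exp (-((1 - m) * L (t, x)))]
  have hKv : -(v' / v₀) ≤ K :=
    (neg_le_abs _).trans (hK t ht x (hball ht x hpos) v' (hvflow t ht x))
  have hfinal : u' / u₀ - v' / v₀ ≤ (1 - m) * K * L (t, x) := by
    calc u' / u₀ - v' / v₀ ≤ (1 - E) * -(v' / v₀) := by linarith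
      _ ≤ (1 - E) * K := mul_le_mul_of_nonneg_left hKv (by linarith)
      _ ≤ (1 - m) * L (t, x) * K := mul_le_mul_of_nonneg_right hE₂ hK₀
      _ = (1 - m) * K * L (t, x) := by ring
  have : l * L (t, x) = (1 - m) * K * L (t, x) + L (t, x) := by ring
  linarith

end TimeSlab

/-- Uniqueness for the Yamabe flow in porous-medium form `∂ₜ u = c_n Δ(u^m)` on flat `ℝ^n`:
two smooth positive solutions agreeing outside a ball and at `t = 0` coincide. -/
theorem yamabe_flow_uniqueness (n : ℕ) (hn : 3 ≤ n) (m cn T : ℝ)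
    (hm : m = ((n : ℝ) - 2) / ((n : ℝ) + 2)) (hcn : cn = 4 * ((n : ℝ) - 1) / ((n : ℝ) - 2))
    (hT : 0 < T)
    (u v : ℝ × EuclideanSpace ℝ (Fin n) → ℝ)
    (hu : ContDiffOn ℝ (⊤ : ℕ∞) u (Set.Icc 0 T ×ˢ Set.univ))
    (hv : ContDiffOn ℝ (⊤ : ℕ∞) v (Set.Icc 0 T ×ˢ Set.univ))
    (hupos : ∀ t ∈ Set.Icc (0 : ℝ) T, ∀ x, 0 < u (t, x))
    (hvpos : ∀ t ∈ Set.Icc (0 : ℝ) T, ∀ x, 0 < v (t, x))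
    (huflow : ∀ t ∈ Set.Icc (0 : ℝ) T, ∀ x,
      HasDerivWithinAt (fun s => u (s, x)) (cn * lap (fun y => u (t, y) ^ m) x)
        (Set.Icc 0 T) t)
    (hvflow : ∀ t ∈ Set.Icc (0 : ℝ) T, ∀ x,
      HasDerivWithinAt (fun s => v (s, x)) (cn * lap (fun y => v (t, y) ^ m) x)
        (Set.Icc 0 T) t)
    (R₀ : ℝ) (hR₀ : 0 < R₀)
    (hout : ∀ t ∈ Set.Icc (0 : ℝ) T, ∀ x : EuclideanSpace ℝ (Fin n),
      R₀ ≤ ‖x‖ → u (t, x) = v (t, x))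
    (hinit : ∀ x, u (0, x) = v (0, x)) :
    ∀ t ∈ Set.Icc (0 : ℝ) T, ∀ x, u (t, x) = v (t, x) := by
  have hn' : (3 : ℝ) ≤ n := by exact_mod_cast hn
  have hm₀ : 0 < m := hm ▸ div_pos (by linarith) (by linarith)
  have hm₁ : m < 1 := by
    rw [hm, div_lt_one (by linarith)]
    linarith
  have hc : 0 < cn := hcn ▸ div_pos (by linarith) (by linarith)
  intro t ht x
  exact le_antisymm
    (le_of_porous_medium_flow hm₀ hm₁ hc hT hu hv hupos hvpos huflow hvflow
      (fun t ht x hx => (hout t ht x hx).le) (fun x => (hinit x).le) t ht x)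
    (le_of_porous_medium_flow hm₀ hm₁ hc hT hv hu hvpos hupos hvflow huflow
      (fun t ht x hx => (hout t ht x hx).ge) (fun x => (hinit x).ge) t ht x)
end
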